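/- arXiv:2412.08253 — 2 statements merged into one kernel-verified Lean document; each statement's English description precedes it below -/
import Mathlib

section
/- Let φ ∈ O(V) and assume φ is reversed by an involution σ ∈ O(V), i.e. σ² = 1 and σφσ⁻¹ = φ⁻¹. Then V admits a decomposition V = U₁ ⊥ U₂ ⊥ … ⊥ U_m into pairwise orthogonal subspaces Uⱼ such that each Uⱼ is nondegenerate, φ-invariant and σ-invariant, and the restriction of φ to each Uⱼ is orthogonally indecomposable. -/
open Polynomial

noncomputable section

namespace GenBireflect

variable {K : Type*} [Field K] {M : Type*} [AddCommGroup M] [Module K M]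
variable (B : LinearMap.BilinForm K M)

/-- The orthogonal group of the bilinear space `(M, B)`. -/
def OG : Subgroup (M ≃ₗ[K] M) where
  carrier := {φ | ∀ x y, B (φ x) (φ y) = B x y}
  one_mem' := fun _ _ => rfl
  mul_mem' := by
    intro a b ha hb x y
    exact (ha (b x) (b y)).trans (hb x y)
  inv_mem' := by
    intro φ h x y
    have := h (φ⁻¹ x) (φ⁻¹ y)
    have e : ∀ z, φ (φ⁻¹ z) = z := fun z => φ.apply_symm_apply z
    rw [e, e] at this
    exact this.symm

/-- The commutator subgroup `Ω(M, B)` of the orthogonal group. -/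
def ΩG : Subgroup (M ≃ₗ[K] M) := ⁅OG B, OG B⁆

def IsNondegOn (U : Submodule K M) : Prop :=
  ∀ x ∈ U, (∀ y ∈ U, B x y = 0) → x = 0

def orthComp (U : Submodule K M) : Submodule K M where
  carrier := {x | ∀ y ∈ U, B x y = 0}
  add_mem' := by
    intro a b ha hb y hy
    simp [map_add, LinearMap.add_apply, ha y hy, hb y hy]
  zero_mem' := by intro y hy; simp
  smul_mem' := by
    intro c a ha y hy
    simp [map_smul, LinearMap.smul_apply, ha y hy]

def InvariantUnder (φ : M ≃ₗ[K] M) (U : Submodule K M) : Prop :=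
  ∀ x ∈ U, φ x ∈ U

def IsOrthSummand (φ : M ≃ₗ[K] M) (U : Submodule K M) : Prop :=
  InvariantUnder φ U ∧ IsNondegOn B U ∧ InvariantUnder φ (orthComp B U)

def IsOrthSummandIn (φ : M ≃ₗ[K] M) (U W : Submodule K M) : Prop :=
  W ≤ U ∧ InvariantUnder φ W ∧ IsNondegOn B W ∧ InvariantUnder φ (U ⊓ orthComp B W)

def IndecomposableOn (φ : M ≃ₗ[K] M) (U : Submodule K M) : Prop :=
  U ≠ ⊥ ∧ ∀ W, IsOrthSummandIn B φ U W → W = ⊥ ∨ W = U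

def Indecomposable (φ : M ≃ₗ[K] M) : Prop := IndecomposableOn B φ ⊤

def CyclicOn (φ : M ≃ₗ[K] M) (U : Submodule K M) : Prop :=
  ∃ u : M, U = Submodule.span K (Set.range fun i : ℕ => ((φ : M →ₗ[K] M) ^ i) u)

def MinpolyOn (φ : M ≃ₗ[K] M) (U : Submodule K M) (f : K[X]) : Prop :=
  ∃ h : ∀ x ∈ U, (φ : M →ₗ[K] M) x ∈ U,
    minpoly K (((φ : M →ₗ[K] M).restrict h : U →ₗ[K] U)) = f

def TotallyIsotropic (T : Submodule K M) : Prop :=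
  ∀ x ∈ T, ∀ y ∈ T, B x y = 0

def IsHyperbolic (U : Submodule K M) : Prop :=
  ∃ T : Submodule K M, T ≤ U ∧ TotallyIsotropic B T ∧
    2 * Module.finrank K T = Module.finrank K U

def Bahn (φ : M ≃ₗ[K] M) : Submodule K M :=
  LinearMap.range ((φ : M →ₗ[K] M) - LinearMap.id)

def Fix (φ : M ≃ₗ[K] M) : Submodule K M :=
  LinearMap.ker ((φ : M →ₗ[K] M) - LinearMap.id)

/-- The reflection along an anisotropic vector `v`: `x ↦ x - (2 B x v / B v v) • v`. -/
def reflMap (v : M) : M →ₗ[K] M :=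
  LinearMap.id - (B.flip v).smulRight ((2 / B v v) • v)

/-- `l` is a list of anisotropic vectors expressing `φ` as the product of the
corresponding reflections. -/
def IsReflExpr (φ : M ≃ₗ[K] M) (l : List M) : Prop :=
  (∀ v ∈ l, B v v ≠ 0) ∧ (φ : M →ₗ[K] M) = (l.map (reflMap B)).prod

/-- The product `B v₁ v₁ ⋯ B v_k v_k` attached to a list of vectors. -/
def sprod (l : List M) : K := (l.map fun v => B v v).prod

/-- `φ` is of type 1: `M = W₁ ⊕ W₂` with `W₁, W₂` nonzero `φ`-invariant subspaces on
which `φ` is cyclic with equal minimal polynomials `(X - ε)^m`, `ε = ±1`. -/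
def IsType1 (φ : M ≃ₗ[K] M) : Prop :=
  ∃ (W₁ W₂ : Submodule K M) (ε : K) (m : ℕ),
    W₁ ≠ ⊥ ∧ W₂ ≠ ⊥ ∧ W₁ ⊓ W₂ = ⊥ ∧ W₁ ⊔ W₂ = ⊤ ∧
    InvariantUnder φ W₁ ∧ InvariantUnder φ W₂ ∧
    CyclicOn φ W₁ ∧ CyclicOn φ W₂ ∧ (ε = 1 ∨ ε = -1) ∧
    MinpolyOn φ W₁ ((X - C ε) ^ m) ∧ MinpolyOn φ W₂ ((X - C ε) ^ m)

/-- `φ` is of type 2±: cyclic on `M` with minimal polynomial `(X - ε)^(dim M)`, `ε = ±1`. -/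
def IsType2pm (φ : M ≃ₗ[K] M) : Prop :=
  CyclicOn φ ⊤ ∧ ∃ ε : K, (ε = 1 ∨ ε = -1) ∧
    minpoly K (φ : M →ₗ[K] M) = (X - C ε) ^ (Module.finrank K M)


section Reversal

variable {B}

/-- `f` is an isometry with inverse `g`, reversed by the isometric involution `σ`, for the
nondegenerate symmetric form `B`. -/
structure IsReversal (B : LinearMap.BilinForm K M) (f g σ : Module.End K M) : Prop where
  symm : ∀ x y, B x y = B y x
  nondeg : ∀ x, (∀ y, B x y = 0) → x = 0
  apply_inv : ∀ x, f (g x) = x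
  inv_apply : ∀ x, g (f x) = x
  adjoint : ∀ x y, B (f x) y = B x (g y)
  invol : ∀ x, σ (σ x) = x
  invol_adjoint : ∀ x y, B (σ x) y = B x (σ y)
  invol_apply : ∀ x, σ (f x) = g (σ x)

/-- The only nonzero nondegenerate subspace stable under `f`, `g` and `σ` is the whole space. -/
def OnlyTrivialSummands (B : LinearMap.BilinForm K M) (f g σ : Module.End K M) : Prop :=
  ∀ W : Submodule K M, (∀ x ∈ W, f x ∈ W) → (∀ x ∈ W, g x ∈ W) → (∀ x ∈ W, σ x ∈ W) →
    IsNondegOn B W → W ≠ ⊥ → W = ⊤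

/-- The space is not the orthogonal sum of two nonzero `f`- and `g`-stable subspaces. -/
def NoOrthSplitting (B : LinearMap.BilinForm K M) (f g : Module.End K M) : Prop :=
  ∀ X Y : Submodule K M, (∀ x ∈ X, f x ∈ X) → (∀ x ∈ X, g x ∈ X) → (∀ y ∈ Y, f y ∈ Y) →
    (∀ y ∈ Y, g y ∈ Y) → (∀ x ∈ X, ∀ y ∈ Y, B x y = 0) → X ⊔ Y = ⊤ → X = ⊥ ∨ Y = ⊥

lemma commute_aeval {s x : Module.End K M} (h : Commute s x) (p : K[X]) :
    Commute (aeval s p) x := by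
  induction p using Polynomial.induction_on' with
  | add p q hp hq => rw [map_add]; exact hp.add_left hq
  | monomial n a =>
    rw [aeval_monomial]
    exact Commute.mul_left (Algebra.commutes a x) (h.pow_left n)

lemma pow_selfAdjoint {s : Module.End K M} (h : ∀ x y, B (s x) y = B x (s y)) (n : ℕ) (x y : M) :
    B ((s ^ n) x) y = B x ((s ^ n) y) := by
  induction n generalizing x y with
  | zero => simp
  | succ n ih =>
    rw [pow_succ, Module.End.mul_apply, ih, h, ← Module.End.mul_apply, ← pow_succ', pow_succ]

lemma aeval_selfAdjoint {s : Module.End K M} (h : ∀ x y, B (s x) y = B x (s y)) (p : K[X])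
    (x y : M) : B (aeval s p x) y = B x (aeval s p y) := by
  induction p using Polynomial.induction_on' with
  | add p q hp hq => simp [hp, hq]
  | monomial n a => simp [aeval_monomial, pow_selfAdjoint h n x y]

lemma aeval_aeval_comm (T : Module.End K M) (p q : K[X]) (x : M) :
    aeval T p (aeval T q x) = aeval T q (aeval T p x) := by
  rw [← Module.End.mul_apply, ← map_mul, mul_comm, map_mul, Module.End.mul_apply]

/-- In a cyclic primary module, every nonzero submodule contains the socle. -/
lemma exists_aeval_mul_eq_socle {T : Module.End K M} {q : K[X]} (hq : Irreducible q) {k : ℕ}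
    {u : M} (hk : aeval T (q ^ (k + 1)) u = 0) {a : K[X]} (ha : aeval T a u ≠ 0) :
    ∃ c : K[X], aeval T (q ^ k) u = aeval T (c * a) u := by
  classical
  obtain ⟨i, hi, e⟩ := (dvd_prime_pow hq.prime (k + 1)).1 (gcd_dvd_right a (q ^ (k + 1)))
  have hik : i ≤ k := by
    by_contra hlt
    have : i = k + 1 := by omega
    subst this
    obtain ⟨r, hr⟩ := e.symm.dvd.trans (gcd_dvd_left a (q ^ (k + 1)))
    exact ha (by rw [hr, mul_comm, map_mul, Module.End.mul_apply, hk, map_zero])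
  obtain ⟨b, c, hbc⟩ := exists_gcd_eq_mul_add_mul a (q ^ (k + 1))
  obtain ⟨r, hr⟩ := e.dvd.trans (pow_dvd_pow q hik)
  refine ⟨b * r, ?_⟩
  rw [hr, hbc]
  have : (a * b + q ^ (k + 1) * c) * r = b * r * a + (c * r) * q ^ (k + 1) := by ring
  rw [this, map_add, LinearMap.add_apply, map_mul _ (c * r), Module.End.mul_apply, hk, map_zero,
    add_zero]

namespace IsReversal

variable {f g σ : Module.End K M}

lemma invol_inv (h : IsReversal B f g σ) (x : M) : σ (g x) = f (σ x) := by
  have := h.invol_apply (g x)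
  rw [h.apply_inv] at this
  rw [this, h.apply_inv]

lemma adjoint_inv (h : IsReversal B f g σ) (x y : M) : B (g x) y = B x (f y) := by
  rw [h.symm, ← h.adjoint, h.symm]

lemma eq_zero_of_eigen (h : IsReversal B f g σ) (h2 : (2 : K) ≠ 0) {η : K} (hη : η * η = 1)
    {x y : M} (hx : σ x = η • x) (hy : σ y = -(η • y)) : B x y = 0 := by
  have e : B x y = -B x y := by
    conv_lhs => rw [← h.invol x, h.invol_adjoint, hx, hy]
    simp only [map_neg, map_smul, LinearMap.smul_apply, smul_eq_mul, ← mul_assoc, hη, one_mul]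
  have : 2 * B x y = 0 := by linear_combination e
  simpa [h2] using this

lemma exists_eigen (h : IsReversal B f g σ) (h2 : (2 : K) ≠ 0) {T : Module.End K M}
    (hT : ∀ x y, B (T x) y = B x (T y)) (hσ : ∀ x, σ (T x) = T (σ x)) (h0 : T ≠ 0) :
    ∃ (u : M) (η : K), η * η = 1 ∧ σ u = η • u ∧ B (T u) u ≠ 0 := by
  by_contra! hc
  have hdiag : ∀ x, B (T x) x = 0 := by
    intro x
    have hp : σ (x + σ x) = (1 : K) • (x + σ x) := by rw [map_add, h.invol, one_smul, add_comm]
    have hm : σ (x - σ x) = (-1 : K) • (x - σ x) := by rw [map_sub, h.invol]; simp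
    have a1 := hc _ 1 (by simp) hp
    have a2 := hc _ (-1) (by simp) hm
    have a3 : B (T (x + σ x)) (x - σ x) = 0 :=
      h.eq_zero_of_eigen h2 (η := 1) (by simp) (by rw [hσ, hp, map_smul]) (by rw [hm]; simp)
    have a4 : B (T (x - σ x)) (x + σ x) = 0 := by rw [hT, h.symm]; exact a3
    simp only [map_add, map_sub, LinearMap.add_apply, LinearMap.sub_apply] at a1 a2 a3 a4
    have : (2 * 2) * B (T x) x = 0 := by linear_combination a1 + a2 + a3 + a4
    simpa [h2] using this
  refine h0 (LinearMap.ext fun x => h.nondeg _ fun y => ?_)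
  have a := hdiag (x + y)
  simp only [map_add, LinearMap.add_apply, hdiag] at a
  have b : B (T y) x = B (T x) y := by rw [hT, h.symm]
  have : 2 * B (T x) y = 0 := by linear_combination a - b
  simpa [h2] using this

/-- A non-injective self-adjoint operator commuting with everything is nilpotent. -/
lemma exists_pow_eq_zero [FiniteDimensional K M] (h : IsReversal B f g σ)
    (hmin : OnlyTrivialSummands B f g σ) {T : Module.End K M}
    (hT : ∀ x y, B (T x) y = B x (T y)) (hf : Commute T f) (hg : Commute T g) (hσ : Commute T σ)
    {x : M} (hx : x ≠ 0) (hTx : T x = 0) : ∃ N, T ^ N = 0 := by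
  obtain ⟨N, hN, hN1⟩ :=
    (T.eventually_isCompl_ker_pow_range_pow.and (Filter.eventually_ge_atTop 1)).exists
  refine ⟨N, LinearMap.ker_eq_top.1 (hmin _ ?_ ?_ ?_ ?_ ?_)⟩
  · exact fun y hy => by
      rw [LinearMap.mem_ker, ← Module.End.mul_apply, (hf.pow_left N).eq, Module.End.mul_apply,
        LinearMap.mem_ker.1 hy, map_zero]
  · exact fun y hy => by
      rw [LinearMap.mem_ker, ← Module.End.mul_apply, (hg.pow_left N).eq, Module.End.mul_apply,
        LinearMap.mem_ker.1 hy, map_zero]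
  · exact fun y hy => by
      rw [LinearMap.mem_ker, ← Module.End.mul_apply, (hσ.pow_left N).eq, Module.End.mul_apply,
        LinearMap.mem_ker.1 hy, map_zero]
  · intro y hy hyo
    refine h.nondeg y fun z => ?_
    obtain ⟨a, ha, b, ⟨c, rfl⟩, rfl⟩ :=
      Submodule.mem_sup.1 (hN.sup_eq_top ▸ Submodule.mem_top (x := z))
    rw [map_add, hyo a ha, ← pow_selfAdjoint hT, LinearMap.mem_ker.1 hy]
    simp
  · refine fun hb => hx ((Submodule.eq_bot_iff _).1 hb x ?_)
    obtain ⟨n, rfl⟩ := Nat.exists_eq_add_of_le' hN1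
    rw [LinearMap.mem_ker, pow_succ, Module.End.mul_apply, hTx, map_zero]

lemma exists_pow_ne_zero [Nontrivial M] {T : Module.End K M} (hT : ∃ N, T ^ N = 0) :
    ∃ k, T ^ (k + 1) = 0 ∧ T ^ k ≠ 0 := by
  classical
  have h1 := Nat.find_spec hT
  have h2 : Nat.find hT ≠ 0 := by
    intro h0
    rw [h0, pow_zero] at h1
    exact one_ne_zero h1
  obtain ⟨k, hk⟩ := Nat.exists_eq_succ_of_ne_zero h2
  exact ⟨k, by rw [hk] at h1; exact h1, Nat.find_min hT (by omega)⟩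

lemma disjoint_of_sup_eq_top (h : IsReversal B f g σ) {X Y : Submodule K M}
    (hXY : ∀ x ∈ X, ∀ y ∈ Y, B x y = 0) (hs : X ⊔ Y = ⊤) {z : M} (hX : z ∈ X) (hY : z ∈ Y) :
    z = 0 := by
  refine h.nondeg z fun w => ?_
  obtain ⟨a, ha, b, hb, rfl⟩ := Submodule.mem_sup.1 (hs ▸ Submodule.mem_top (x := w))
  rw [map_add, hXY z hX b hb, h.symm, hXY a ha z hY, add_zero]

lemma commute_inv (h : IsReversal B f g σ) : Commute f g :=
  LinearMap.ext fun x => (h.apply_inv x).trans (h.inv_apply x).symm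

lemma trace_selfAdjoint (h : IsReversal B f g σ) (x y : M) :
    B ((f + g) x) y = B x ((f + g) y) := by
  simp [h.adjoint, h.adjoint_inv, add_comm]

lemma trace_commute_invol (h : IsReversal B f g σ) : Commute (f + g) σ :=
  LinearMap.ext fun x => by simp [h.invol_apply, h.invol_inv, add_comm]

lemma trace_commute_left (h : IsReversal B f g σ) : Commute (f + g) f :=
  (Commute.refl f).add_left h.commute_inv.symm

lemma trace_commute_right (h : IsReversal B f g σ) : Commute (f + g) g :=
  h.commute_inv.add_left (Commute.refl g)

lemma aeval_trace_sub (h : IsReversal B f g σ) (p : K[X]) (x : M) :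
    aeval (f + g) p ((f - g) x) = (f - g) (aeval (f + g) p x) :=
  LinearMap.congr_fun
    (commute_aeval (h.trace_commute_left.sub_right h.trace_commute_right) p).eq x

lemma aeval_trace_invol (h : IsReversal B f g σ) (p : K[X]) (x : M) :
    σ (aeval (f + g) p x) = aeval (f + g) p (σ x) :=
  (LinearMap.congr_fun (commute_aeval h.trace_commute_invol p).eq x).symm

lemma sub_sub_apply (h : IsReversal B f g σ) (p : K[X]) (x : M) :
    (f - g) ((f - g) (aeval (f + g) p x)) = aeval (f + g) ((X ^ 2 - C 4) * p) x := by
  rw [map_mul, Module.End.mul_apply, map_sub, map_pow, aeval_X, aeval_C, pow_two]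
  generalize aeval (f + g) p x = y
  have e4 : (4 : K) • y = y + y + y + y := by module
  simp only [LinearMap.sub_apply, map_sub, h.apply_inv, h.inv_apply,
    Module.End.mul_apply, LinearMap.add_apply, map_add, Module.algebraMap_end_apply, e4]
  abel

lemma sub_adjoint (h : IsReversal B f g σ) (x y : M) :
    B ((f - g) x) y = -B x ((f - g) y) := by
  simp [h.adjoint, h.adjoint_inv]

lemma invol_sub (h : IsReversal B f g σ) (x : M) : σ ((f - g) x) = -(f - g) (σ x) := by
  simp [h.invol_apply, h.invol_inv]

lemma left_eq (h2 : (2 : K) ≠ 0) (x : M) :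
    f x = (2 : K)⁻¹ • ((f + g) x + (f - g) x) := by
  have : (f + g) x + (f - g) x = (2 : K) • f x := by
    rw [two_smul, LinearMap.add_apply, LinearMap.sub_apply]; abel
  rw [this, inv_smul_smul₀ h2]

lemma right_eq (h2 : (2 : K) ≠ 0) (x : M) :
    g x = (2 : K)⁻¹ • ((f + g) x - (f - g) x) := by
  have : (f + g) x - (f - g) x = (2 : K) • g x := by
    rw [two_smul, LinearMap.add_apply, LinearMap.sub_apply]; abel
  rw [this, inv_smul_smul₀ h2]

/-- In the cyclic case every orthogonal summand of `f` is stable under `σ`, since the orthogonal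
projection onto it is a self-adjoint element of the algebra generated by `f`. -/
lemma noOrthSplitting_of_cyclic (h : IsReversal B f g σ)
    (hmin : OnlyTrivialSummands B f g σ) {u : M}
    (hu : ∀ x, ∃ a b : K[X], x = aeval (f + g) a u + (f - g) (aeval (f + g) b u)) :
    NoOrthSplitting B f g := by
  intro S Y hSf hSg hYf hYg hSY hsup
  obtain ⟨x₀, hx₀, y₀, hy₀, huxy⟩ := Submodule.mem_sup.1 (hsup ▸ Submodule.mem_top (x := u))
  obtain ⟨a, b, hab⟩ := hu x₀
  have stable : ∀ (Z : Submodule K M), (∀ x ∈ Z, f x ∈ Z) → (∀ x ∈ Z, g x ∈ Z) →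
      ∀ (p : K[X]), ∀ x ∈ Z, aeval (f + g) p x ∈ Z := by
    intro Z hf hg p x hx
    have hs : ∀ n : ℕ, ((f + g) ^ n) x ∈ Z := by
      intro n
      induction n with
      | zero => simpa using hx
      | succ n ih =>
        rw [pow_succ', Module.End.mul_apply]
        exact Z.add_mem (hf _ ih) (hg _ ih)
    induction p using Polynomial.induction_on' with
    | add p q hp hq => rw [map_add]; exact Z.add_mem hp hq
    | monomial n a => simpa [aeval_monomial] using Z.smul_mem a (hs n)
  set P : Module.End K M := aeval (f + g) a + (f - g) * aeval (f + g) b with hP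
  set P' : Module.End K M := aeval (f + g) a - (f - g) * aeval (f + g) b with hP'
  have comm : ∀ (p : K[X]) (x : M), P (aeval (f + g) p x) = aeval (f + g) p (P x) := by
    intro p x
    simp only [hP, LinearMap.add_apply, Module.End.mul_apply, map_add, h.aeval_trace_sub,
      aeval_aeval_comm _ p]
  have commd : ∀ x : M, P ((f - g) x) = (f - g) (P x) := by
    intro x
    simp only [hP, LinearMap.add_apply, Module.End.mul_apply, map_add, h.aeval_trace_sub]
  have hPu : P u = x₀ := hab.symm
  have hPS : ∀ z, P z ∈ S := by
    intro z
    obtain ⟨c, e, rfl⟩ := hu z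
    rw [map_add, commd, comm, comm, hPu]
    have := stable S hSf hSg e x₀ hx₀
    exact S.add_mem (stable S hSf hSg c x₀ hx₀) (S.sub_mem (hSf _ this) (hSg _ this))
  have hPY : ∀ z, z - P z ∈ Y := by
    intro z
    obtain ⟨c, e, rfl⟩ := hu z
    have e1 : u - x₀ = y₀ := by rw [← huxy]; abel
    rw [map_add, commd, comm, comm, hPu, add_sub_add_comm, ← map_sub, ← map_sub, ← map_sub, e1]
    have := stable Y hYf hYg e y₀ hy₀
    exact Y.add_mem (stable Y hYf hYg c y₀ hy₀) (Y.sub_mem (hYf _ this) (hYg _ this))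
  have hfix : ∀ x ∈ S, P x = x := fun x hx =>
    (sub_eq_zero.1 (h.disjoint_of_sup_eq_top hSY hsup (S.sub_mem hx (hPS x)) (hPY x))).symm
  have hsa : ∀ x y, B (P x) y = B x (P y) := by
    intro x y
    have e1 := hSY _ (hPS x) _ (hPY y)
    have e2 := hSY _ (hPS y) _ (hPY x)
    rw [map_sub] at e1 e2
    rw [h.symm x (P y)]
    rw [h.symm (P y) (P x)] at e2
    linear_combination e1 - e2
  have hadj : ∀ x y, B (P x) y = B x (P' y) := by
    intro x y
    simp only [hP, hP', LinearMap.add_apply, LinearMap.sub_apply (f := aeval (f + g) a), map_add,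
      map_sub (B x), Module.End.mul_apply, aeval_selfAdjoint h.trace_selfAdjoint, h.sub_adjoint,
      h.aeval_trace_sub, sub_eq_add_neg (B x _)]
  have hPP' : ∀ y, P' y = P y := by
    intro y
    refine sub_eq_zero.1 (h.nondeg _ fun x => ?_)
    rw [h.symm, map_sub, ← hadj, hsa, sub_self]
  have hσP : ∀ x, σ (P x) = P' (σ x) := by
    intro x
    simp only [hP, hP', LinearMap.add_apply, LinearMap.sub_apply (f := aeval (f + g) a), map_add,
      Module.End.mul_apply, h.invol_sub, h.aeval_trace_invol, ← sub_eq_add_neg]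
  by_cases hS : S = ⊥
  · exact Or.inl hS
  right
  have htop := hmin S hSf hSg (fun x hx => by rw [← hfix x hx, hσP, hPP']; exact hPS _)
    (fun x hx hxo => h.nondeg x fun z => by
      obtain ⟨a, ha, b, hb, rfl⟩ := Submodule.mem_sup.1 (hsup ▸ Submodule.mem_top (x := z))
      rw [map_add, hxo a ha, hSY x hx b hb, add_zero]) hS
  exact (Submodule.eq_bot_iff _).2 fun y hy =>
    h.disjoint_of_sup_eq_top hSY hsup (htop ▸ Submodule.mem_top) hy

lemma exists_cyclic_generator [FiniteDimensional K M] [Nontrivial M] (h : IsReversal B f g σ)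
    (h2 : (2 : K) ≠ 0) (hmin : OnlyTrivialSummands B f g σ) (hd : ∀ x, (f - g) x = 0 → x = 0) :
    ∃ u, ∀ x, ∃ a b : K[X], x = aeval (f + g) a u + (f - g) (aeval (f + g) b u) := by
  have hint : IsIntegral K (f + g) := Algebra.IsIntegral.isIntegral _
  obtain ⟨q, hq, r, hr⟩ :=
    WfDvdMonoid.exists_irreducible_factor (minpoly.not_isUnit K (f + g)) (minpoly.ne_zero hint)
  have hker : ∃ x, x ≠ 0 ∧ aeval (f + g) q x = 0 := by
    by_contra! hc
    have hr0 : aeval (f + g) r = 0 := by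
      ext x
      by_contra hx
      apply hc _ hx
      rw [← Module.End.mul_apply, ← map_mul, ← hr, minpoly.aeval, LinearMap.zero_apply]
    have hr1 : r ≠ 0 := by
      rintro rfl
      exact minpoly.ne_zero hint (by simpa using hr)
    obtain ⟨w, hw⟩ := minpoly.dvd K _ hr0
    apply hq.not_isUnit
    refine IsUnit.of_mul_eq_one w (mul_left_cancel₀ hr1 ?_)
    rw [mul_one]
    conv_rhs => rw [hw, hr]
    ring
  obtain ⟨x, hx, hqx⟩ := hker
  obtain ⟨k, hk, hk0⟩ := exists_pow_ne_zero
    (h.exists_pow_eq_zero hmin (aeval_selfAdjoint h.trace_selfAdjoint q)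
      (commute_aeval h.trace_commute_left q) (commute_aeval h.trace_commute_right q)
      (commute_aeval h.trace_commute_invol q) hx hqx)
  rw [← map_pow] at hk hk0
  obtain ⟨u, η, hη, hu, hBu⟩ := h.exists_eigen h2
    (aeval_selfAdjoint h.trace_selfAdjoint (q ^ k)) (h.aeval_trace_invol _) hk0
  refine ⟨u, ?_⟩
  let W : Submodule K M :=
    { carrier := {x | ∃ a b : K[X], x = aeval (f + g) a u + (f - g) (aeval (f + g) b u)}
      add_mem' := by
        rintro _ _ ⟨a, b, rfl⟩ ⟨a', b', rfl⟩
        exact ⟨a + a', b + b', by simp only [map_add, LinearMap.add_apply _ _ u]; abel⟩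
      zero_mem' := ⟨0, 0, by simp⟩
      smul_mem' := by
        rintro c _ ⟨a, b, rfl⟩
        exact ⟨c • a, c • b, by simp only [map_smul, LinearMap.smul_apply _ _ u, smul_add]⟩ }
  have hWs : ∀ x ∈ W, (f + g) x ∈ W := by
    rintro _ ⟨a, b, rfl⟩
    refine ⟨X * a, X * b, ?_⟩
    have e := h.aeval_trace_sub X (aeval (f + g) b u)
    rw [aeval_X] at e
    rw [map_add, e, map_mul, map_mul, aeval_X, Module.End.mul_apply, Module.End.mul_apply]
  have hWd : ∀ x ∈ W, (f - g) x ∈ W := by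
    rintro _ ⟨a, b, rfl⟩
    exact ⟨(X ^ 2 - C 4) * b, a, by rw [map_add, h.sub_sub_apply, add_comm]⟩
  have hsocle : ∀ a : K[X], (∀ c : K[X], B (aeval (f + g) a u) (aeval (f + g) c u) = 0) →
      aeval (f + g) a u = 0 := by
    intro a ha
    by_contra hne
    obtain ⟨c, hc⟩ := exists_aeval_mul_eq_socle hq (k := k) (by rw [hk, LinearMap.zero_apply]) hne
    apply hBu
    rw [hc, map_mul, Module.End.mul_apply, aeval_selfAdjoint h.trace_selfAdjoint, ha]
  have hσa : ∀ a : K[X], σ (aeval (f + g) a u) = η • aeval (f + g) a u := by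
    intro a; rw [h.aeval_trace_invol, hu, map_smul]
  have hσd : ∀ a : K[X], σ ((f - g) (aeval (f + g) a u)) = -(η • (f - g) (aeval (f + g) a u)) := by
    intro a; rw [h.invol_sub, hσa, map_smul]
  have htop : W = ⊤ := by
    refine hmin W ?_ ?_ ?_ ?_ ?_
    · intro x hx
      rw [left_eq (g := g) h2 x]
      exact W.smul_mem _ (W.add_mem (hWs x hx) (hWd x hx))
    · intro x hx
      rw [right_eq (f := f) h2 x]
      exact W.smul_mem _ (W.sub_mem (hWs x hx) (hWd x hx))
    · rintro _ ⟨a, b, rfl⟩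
      refine ⟨η • a, -(η • b), ?_⟩
      rw [map_add, hσa, hσd]
      simp only [map_smul, map_neg, LinearMap.smul_apply _ _ u, LinearMap.neg_apply]
    · rintro _ ⟨a, b, rfl⟩ ho
      have ha : aeval (f + g) a u = 0 := by
        refine hsocle a fun c => ?_
        have e := ho (aeval (f + g) c u) ⟨c, 0, by simp⟩
        rwa [map_add, LinearMap.add_apply, h.symm ((f - g) _),
          h.eq_zero_of_eigen h2 hη (hσa c) (hσd b), add_zero] at e
      have hb : aeval (f + g) b u = 0 := by
        refine hd _ (hd _ ?_)
        rw [h.sub_sub_apply]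
        refine hsocle _ fun c => ?_
        have e := ho ((f - g) (aeval (f + g) c u)) ⟨0, c, by simp⟩
        rw [ha, zero_add, ← neg_eq_zero, ← h.sub_adjoint, h.sub_sub_apply] at e
        exact e
      rw [ha, hb, map_zero, add_zero]
    · intro hb
      apply hBu
      have : u = 0 := (Submodule.eq_bot_iff _).1 hb u ⟨1, 0, by simp⟩
      rw [this, map_zero]
  intro x
  have : x ∈ W := htop ▸ Submodule.mem_top
  exact this

section Unipotent

variable {ε : K} {k : ℕ}

lemma sub_eps_adjoint (h : IsReversal B f g σ) (j : ℕ) (x y : M) :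
    B (((f - ε • 1) ^ j) x) y = B x (((g - ε • 1) ^ j) y) := by
  induction j generalizing x y with
  | zero => simp
  | succ j ih =>
    rw [pow_succ, Module.End.mul_apply, ih, pow_succ', Module.End.mul_apply]
    simp [h.adjoint]

lemma invol_sub_eps (h : IsReversal B f g σ) (j : ℕ) (x : M) :
    σ (((f - ε • 1) ^ j) x) = ((g - ε • 1) ^ j) (σ x) := by
  induction j generalizing x with
  | zero => simp
  | succ j ih =>
    rw [pow_succ, Module.End.mul_apply, ih, pow_succ, Module.End.mul_apply]
    simp [h.invol_apply]

lemma inv_sub_eps (h : IsReversal B f g σ) (hε : ε * ε = 1) :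
    g - ε • 1 = (-ε) • (g * (f - ε • 1)) := by
  ext x
  simp [h.inv_apply, smul_sub, smul_smul, hε]

lemma inv_sub_eps_pow (h : IsReversal B f g σ) (hε : ε * ε = 1)
    (hk : (f - ε • 1) ^ (k + 1) = 0) :
    (g - ε • 1) ^ k = (-1 : K) ^ k • (f - ε • 1) ^ k := by
  have hc : Commute g (f - ε • 1) :=
    h.commute_inv.symm.sub_right ((Commute.one_right g).smul_right ε)
  have hg : g * (f - ε • 1) ^ k = ε • (f - ε • 1) ^ k := by
    have e := h.inv_sub_eps hε
    have e' : (g - ε • 1) * (f - ε • 1) ^ k = 0 := by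
      rw [e, smul_mul_assoc, mul_assoc, ← pow_succ', hk, mul_zero, smul_zero]
    rw [sub_mul, sub_eq_zero] at e'
    rw [e', smul_mul_assoc, one_mul]
  have hgj : ∀ j : ℕ, g ^ j * (f - ε • 1) ^ k = ε ^ j • (f - ε • 1) ^ k := by
    intro j
    induction j with
    | zero => simp
    | succ j ih => rw [pow_succ, mul_assoc, hg, mul_smul_comm, ih, smul_smul, pow_succ']
  rw [h.inv_sub_eps hε, _root_.smul_pow, hc.mul_pow, hgj, smul_smul, ← mul_pow, neg_mul, hε]

lemma eq_bot_of_sup_range_eq_top (h : IsReversal B f g σ) (hk : (f - ε • 1) ^ (k + 1) = 0)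
    {S Y : Submodule K M} (hSf : ∀ x ∈ S, f x ∈ S) (hYf : ∀ y ∈ Y, f y ∈ Y)
    (hSY : ∀ x ∈ S, ∀ y ∈ Y, B x y = 0) (hsup : S ⊔ Y = ⊤)
    (hr : S ⊔ LinearMap.range (f - ε • 1) = ⊤) : Y = ⊥ := by
  have hS : ∀ x ∈ S, (f - ε • 1) x ∈ S := fun x hx => S.sub_mem (hSf x hx) (S.smul_mem ε hx)
  have hY : ∀ x ∈ Y, (f - ε • 1) x ∈ Y := fun x hx => Y.sub_mem (hYf x hx) (Y.smul_mem ε hx)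
  have step : ∀ y ∈ Y, ∃ y' ∈ Y, (f - ε • 1) y' = y := by
    intro y hy
    obtain ⟨x, hx, _, ⟨z, rfl⟩, hxz⟩ := Submodule.mem_sup.1 (hr ▸ Submodule.mem_top (x := y))
    obtain ⟨x', hx', y', hy', rfl⟩ := Submodule.mem_sup.1 (hsup ▸ Submodule.mem_top (x := z))
    refine ⟨y', hy', (sub_eq_zero.1 (h.disjoint_of_sup_eq_top hSY hsup ?_
      (Y.sub_mem hy (hY _ hy')))).symm⟩
    have : y - (f - ε • 1) y' = x + (f - ε • 1) x' := by
      rw [← hxz, map_add]; abel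
    rw [this]
    exact S.add_mem hx (hS _ hx')
  have iter : ∀ j : ℕ, ∀ y ∈ Y, ∃ y' ∈ Y, ((f - ε • 1) ^ j) y' = y := by
    intro j
    induction j with
    | zero => exact fun y hy => ⟨y, hy, by simp⟩
    | succ j ih =>
      intro y hy
      obtain ⟨y₁, hy₁, rfl⟩ := ih y hy
      obtain ⟨y₂, hy₂, rfl⟩ := step y₁ hy₁
      exact ⟨y₂, hy₂, by rw [pow_succ, Module.End.mul_apply]⟩
  refine (Submodule.eq_bot_iff _).2 fun y hy => ?_
  obtain ⟨y', -, rfl⟩ := iter (k + 1) y hy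
  rw [hk, LinearMap.zero_apply]

/-- If the form `B (n ^ k x) y`, with `n = f - ε`, is nondegenerate on a `σ`-stable subspace `S`,
then `S` generates the whole space. -/
lemma sup_range_eq_top (h : IsReversal B f g σ) (hmin : OnlyTrivialSummands B f g σ)
    (hε : ε * ε = 1) (hk : (f - ε • 1) ^ (k + 1) = 0) {S : Submodule K M} (hS0 : S ≠ ⊥)
    (hSσ : ∀ x ∈ S, σ x ∈ S)
    (hS : ∀ x ∈ S, (∀ y ∈ S, B (((f - ε • 1) ^ k) x) y = 0) → x = 0) :
    S ⊔ LinearMap.range (f - ε • 1) = ⊤ := by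
  let W : Submodule K M :=
    sInf {P | S ≤ P ∧ (∀ x ∈ P, f x ∈ P) ∧ (∀ x ∈ P, g x ∈ P)}
  have hWle : ∀ P : Submodule K M, S ≤ P → (∀ x ∈ P, f x ∈ P) → (∀ x ∈ P, g x ∈ P) → W ≤ P :=
    fun P h1 h2 h3 => sInf_le ⟨h1, h2, h3⟩
  have hSW : S ≤ W := le_sInf fun P hP => hP.1
  have hWf : ∀ x ∈ W, f x ∈ W := fun x hx =>
    Submodule.mem_sInf.2 fun P hP => hP.2.1 x (Submodule.mem_sInf.1 hx P hP)
  have hWg : ∀ x ∈ W, g x ∈ W := fun x hx =>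
    Submodule.mem_sInf.2 fun P hP => hP.2.2 x (Submodule.mem_sInf.1 hx P hP)
  have hWσ : ∀ x ∈ W, σ x ∈ W := by
    refine hWle (W.comap σ) (fun x hx => hSW (hSσ x hx)) ?_ ?_
    · intro x hx
      rw [Submodule.mem_comap, h.invol_apply]
      exact hWg _ hx
    · intro x hx
      rw [Submodule.mem_comap, h.invol_inv]
      exact hWf _ hx
  have hWn : ∀ x ∈ W, (f - ε • 1) x ∈ W := fun x hx => W.sub_mem (hWf x hx) (W.smul_mem ε hx)
  have hgn : ∀ x, g ((f - ε • 1) x) = (f - ε • 1) (g x) := by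
    intro x; simp [h.apply_inv, h.inv_apply]
  have hdec : W ≤ S ⊔ W.map (f - ε • 1) := by
    refine hWle _ le_sup_left ?_ ?_
    · intro x hx
      obtain ⟨s, hs, _, ⟨w, hw, rfl⟩, rfl⟩ := Submodule.mem_sup.1 hx
      refine Submodule.mem_sup.2 ⟨ε • s, S.smul_mem _ hs, (f - ε • 1) (s + f w),
        ⟨_, W.add_mem (hSW hs) (hWf w hw), rfl⟩, ?_⟩
      simp
      abel
    · intro x hx
      obtain ⟨s, hs, _, ⟨w, hw, rfl⟩, rfl⟩ := Submodule.mem_sup.1 hx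
      refine Submodule.mem_sup.2 ⟨ε • s, S.smul_mem _ hs, (f - ε • 1) (g w - ε • g s),
        ⟨_, W.sub_mem (hWg w hw) (W.smul_mem _ (hWg s (hSW hs))), rfl⟩, ?_⟩
      rw [map_add, hgn, map_sub, map_smul, ← hgn s]
      have : ε • s - ε • g ((f - ε • 1) s) = g s := by
        simp [h.inv_apply, smul_sub, smul_smul, hε]
      rw [← this]
      abel
  have htop : W = ⊤ := by
    refine hmin W hWf hWg hWσ ?_ ?_
    · intro x hx hxo
      have key : ∀ j ≤ k + 1, ∃ w ∈ W, ((f - ε • 1) ^ j) w = x := by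
        intro j
        induction j with
        | zero => exact fun _ => ⟨x, hx, by simp⟩
        | succ j ih =>
          intro hj
          obtain ⟨w, hw, hwx⟩ := ih (by omega)
          obtain ⟨s, hs, _, ⟨w', hw', rfl⟩, rfl⟩ := Submodule.mem_sup.1 (hdec hw)
          have hs0 : s = 0 := by
            refine hS s hs fun y hy => ?_
            obtain ⟨i, hi⟩ := Nat.exists_eq_add_of_le (show j ≤ k by omega)
            have e1 : ((f - ε • 1) ^ k) s = ((f - ε • 1) ^ i) x := by
              rw [← hwx, ← Module.End.mul_apply, ← pow_add, add_comm i j, ← hi, map_add,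
                ← Module.End.mul_apply _ (f - ε • 1) w', ← pow_succ, hk, LinearMap.zero_apply,
                add_zero]
            rw [e1, h.sub_eps_adjoint]
            refine hxo _ ?_
            have : ∀ i : ℕ, ((g - ε • 1) ^ i) y ∈ W := by
              intro i
              induction i with
              | zero => simpa using hSW hy
              | succ i ih =>
                rw [pow_succ', Module.End.mul_apply]
                exact W.sub_mem (hWg _ ih) (W.smul_mem ε ih)
            exact this i
          refine ⟨w', hw', ?_⟩
          rw [← hwx, hs0, zero_add, pow_succ, Module.End.mul_apply]
      obtain ⟨w, -, rfl⟩ := key (k + 1) le_rfl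
      rw [hk, LinearMap.zero_apply]
    · intro hb
      exact hS0 (eq_bot_iff.2 (hb ▸ hSW))
  rw [eq_top_iff, ← htop]
  refine hdec.trans (sup_le_sup_left ?_ S)
  rw [htop, LinearMap.range_eq_map]

/-- If every subspace on which the form `B (n ^ k x) y`, with `n = f - ε`, does not vanish
generates the whole space, then `f` has no orthogonal splitting. -/
lemma noOrthSplitting_of_generating (h : IsReversal B f g σ)
    (hk : (f - ε • 1) ^ (k + 1) = 0) (hk0 : (f - ε • 1) ^ k ≠ 0)
    (hgen : ∀ S : Submodule K M, ∀ x ∈ S, ∀ y ∈ S, B (((f - ε • 1) ^ k) x) y ≠ 0 →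
      S ⊔ LinearMap.range (f - ε • 1) = ⊤) : NoOrthSplitting B f g := by
  intro S Y hSf _ hYf _ hSY hsup
  have hpow : ∀ Z : Submodule K M, (∀ x ∈ Z, f x ∈ Z) → ∀ x ∈ Z, ((f - ε • 1) ^ k) x ∈ Z := by
    intro Z hZ x hx
    generalize k = i
    induction i with
    | zero => simpa using hx
    | succ i ih =>
      rw [pow_succ', Module.End.mul_apply]
      exact Z.sub_mem (hZ _ ih) (Z.smul_mem ε ih)
  have hYS : ∀ y ∈ Y, ∀ x ∈ S, B y x = 0 := fun y hy x hx => by rw [h.symm, hSY x hx y hy]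
  by_cases hS : ∃ x ∈ S, ∃ y ∈ S, B (((f - ε • 1) ^ k) x) y ≠ 0
  · obtain ⟨x, hx, y, hy, hxy⟩ := hS
    exact Or.inr (h.eq_bot_of_sup_range_eq_top hk hSf hYf hSY hsup (hgen S x hx y hy hxy))
  by_cases hY : ∃ x ∈ Y, ∃ y ∈ Y, B (((f - ε • 1) ^ k) x) y ≠ 0
  · obtain ⟨x, hx, y, hy, hxy⟩ := hY
    exact Or.inl (h.eq_bot_of_sup_range_eq_top hk hYf hSf hYS (sup_comm S Y ▸ hsup)
      (hgen Y x hx y hy hxy))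
  push Not at hS hY
  refine absurd (LinearMap.ext fun x => h.nondeg _ fun y => ?_) hk0
  obtain ⟨x₁, hx₁, x₂, hx₂, rfl⟩ := Submodule.mem_sup.1 (hsup ▸ Submodule.mem_top (x := x))
  obtain ⟨y₁, hy₁, y₂, hy₂, rfl⟩ := Submodule.mem_sup.1 (hsup ▸ Submodule.mem_top (x := y))
  simp only [map_add, LinearMap.add_apply, hS x₁ hx₁ y₁ hy₁, hY x₂ hx₂ y₂ hy₂,
    hSY _ (hpow S hSf x₁ hx₁) y₂ hy₂, hYS _ (hpow Y hYf x₂ hx₂) y₁ hy₁, add_zero]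

lemma range_form_eq_zero (h : IsReversal B f g σ) (hε : ε * ε = 1)
    (hk : (f - ε • 1) ^ (k + 1) = 0) (x z : M) :
    B (((f - ε • 1) ^ k) x) ((f - ε • 1) z) = 0 ∧
      B (((f - ε • 1) ^ k) ((f - ε • 1) x)) z = 0 := by
  have e : ∀ x, ((f - ε • 1) ^ k) ((f - ε • 1) x) = 0 := by
    intro x; rw [← Module.End.mul_apply, ← pow_succ, hk, LinearMap.zero_apply]
  constructor
  · rw [h.sub_eps_adjoint, h.inv_sub_eps_pow hε hk, LinearMap.smul_apply, e]; simp
  · rw [e]; simp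

lemma noOrthSplitting_of_even (h : IsReversal B f g σ) (h2 : (2 : K) ≠ 0)
    (hmin : OnlyTrivialSummands B f g σ) (hε : ε * ε = 1) (hk : (f - ε • 1) ^ (k + 1) = 0)
    (hk0 : (f - ε • 1) ^ k ≠ 0) (hev : Even k) : NoOrthSplitting B f g := by
  have hn := h.inv_sub_eps_pow hε hk
  rw [hev.neg_one_pow, one_smul] at hn
  obtain ⟨u, η, hη, hu, hBu⟩ := h.exists_eigen h2 (T := (f - ε • 1) ^ k)
    (fun x y => by rw [h.sub_eps_adjoint, hn]) (fun x => by rw [h.invol_sub_eps, hn]) hk0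
  have hspan := h.sup_range_eq_top hmin hε hk (S := Submodule.span K {u})
    (fun hb => hBu (by rw [Submodule.span_singleton_eq_bot.1 hb, map_zero]))
    (fun x hx => by
      obtain ⟨a, rfl⟩ := Submodule.mem_span_singleton.1 hx
      rw [map_smul, hu]
      exact Submodule.smul_mem _ _ (Submodule.smul_mem _ _ (Submodule.mem_span_singleton_self u)))
    (fun x hx hxo => by
      obtain ⟨a, rfl⟩ := Submodule.mem_span_singleton.1 hx
      have := hxo u (Submodule.mem_span_singleton_self u)
      rw [map_smul, map_smul, LinearMap.smul_apply, smul_eq_mul, mul_eq_zero] at this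
      rw [this.resolve_right hBu, zero_smul])
  refine h.noOrthSplitting_of_generating hk hk0 fun S x hx y hy hxy => ?_
  obtain ⟨_, hs, _, ⟨z, rfl⟩, rfl⟩ := Submodule.mem_sup.1 (hspan ▸ Submodule.mem_top (x := x))
  obtain ⟨a, rfl⟩ := Submodule.mem_span_singleton.1 hs
  have ha : a ≠ 0 := by
    rintro rfl
    apply hxy
    rw [zero_smul, zero_add, (h.range_form_eq_zero hε hk z y).2]
  rw [eq_top_iff, ← hspan]
  refine sup_le ((Submodule.span_singleton_le_iff_mem _ _).2 ?_) le_sup_right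
  have : u = a⁻¹ • (a • u + (f - ε • 1) z) - a⁻¹ • (f - ε • 1) z := by
    rw [smul_add, inv_smul_smul₀ ha]; abel
  rw [this]
  exact Submodule.sub_mem _ (Submodule.smul_mem _ _ (Submodule.mem_sup_left hx))
    (Submodule.smul_mem _ _ (Submodule.mem_sup_right ⟨z, rfl⟩))

lemma noOrthSplitting_of_odd (h : IsReversal B f g σ) (h2 : (2 : K) ≠ 0)
    (hmin : OnlyTrivialSummands B f g σ) (hε : ε * ε = 1) (hk : (f - ε • 1) ^ (k + 1) = 0)
    (hk0 : (f - ε • 1) ^ k ≠ 0) (hodd : Odd k) : NoOrthSplitting B f g := by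
  have hn := h.inv_sub_eps_pow hε hk
  have hrange := h.range_form_eq_zero hε hk
  have hadj := h.sub_eps_adjoint (ε := ε) k
  have hσt := h.invol_sub_eps (ε := ε) k
  rw [hn, hodd.neg_one_pow, neg_one_smul] at hadj hσt
  set t := (f - ε • 1) ^ k with ht
  have hskew : ∀ x y, B (t x) y = -B (t y) x := by
    intro x y
    rw [hadj, LinearMap.neg_apply, map_neg, h.symm]
  have halt : ∀ x, B (t x) x = 0 := by
    intro x
    have : 2 * B (t x) x = 0 := by linear_combination hskew x x
    simpa [h2] using this
  have hiso : ∀ η : K, η * η = 1 → ∀ x y, σ x = η • x → σ y = η • y → B (t x) y = 0 := by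
    intro η hη x y hx hy
    rw [h.symm]
    exact h.eq_zero_of_eigen h2 hη hy (by rw [hσt, hx, LinearMap.neg_apply, map_smul])
  obtain ⟨u, v, hu, hv, huv⟩ :
      ∃ u v, σ u = (1 : K) • u ∧ σ v = (-1 : K) • v ∧ B (t u) v ≠ 0 := by
    by_contra! hc
    refine hk0 (LinearMap.ext fun x => h.nondeg _ fun y => ?_)
    have hp : ∀ x, σ (x + σ x) = (1 : K) • (x + σ x) := fun x => by
      rw [map_add, h.invol, one_smul, add_comm]
    have hm : ∀ x, σ (x - σ x) = (-1 : K) • (x - σ x) := fun x => by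
      rw [map_sub, h.invol]; simp
    have a1 := hiso 1 (by simp) _ _ (hp x) (hp y)
    have a2 := hiso (-1) (by simp) _ _ (hm x) (hm y)
    have a3 := hc _ _ (hp x) (hm y)
    have a4 := hc _ _ (hp y) (hm x)
    rw [hskew] at a4
    simp only [map_add, map_sub, LinearMap.add_apply, LinearMap.sub_apply] at a1 a2 a3 a4
    have : (2 * 2) * B (t x) y = 0 := by linear_combination a1 + a2 + a3 - a4
    simpa [h2] using this
  have hvu : B (t v) u = -B (t u) v := hskew v u
  have hus : u ∈ Submodule.span K {u, v} := Submodule.subset_span (by simp)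
  have hvs : v ∈ Submodule.span K {u, v} := Submodule.subset_span (by simp)
  have hspan := h.sup_range_eq_top hmin hε hk (S := Submodule.span K {u, v})
    (fun hb => huv (by rw [(Submodule.eq_bot_iff _).1 hb u hus]; simp))
    (fun x hx => by
      obtain ⟨a, b, rfl⟩ := Submodule.mem_span_pair.1 hx
      rw [map_add, map_smul, map_smul, hu, hv]
      exact Submodule.add_mem _ (Submodule.smul_mem _ _ (Submodule.smul_mem _ _ hus))
        (Submodule.smul_mem _ _ (Submodule.smul_mem _ _ hvs)))
    (fun x hx hxo => by
      obtain ⟨a, b, rfl⟩ := Submodule.mem_span_pair.1 hx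
      have e1 := hxo v hvs
      have e2 := hxo u hus
      rw [← ht] at e1 e2
      simp only [map_add, map_smul, LinearMap.add_apply, LinearMap.smul_apply, halt, smul_eq_mul,
        mul_zero, add_zero, zero_add, hvu, mul_neg, neg_eq_zero, mul_eq_zero, huv, or_false]
        at e1 e2
      rw [e1, e2]; simp)
  refine h.noOrthSplitting_of_generating hk hk0 fun S x hx y hy hxy => ?_
  obtain ⟨_, hs, _, ⟨z, rfl⟩, rfl⟩ := Submodule.mem_sup.1 (hspan ▸ Submodule.mem_top (x := x))
  obtain ⟨_, hs', _, ⟨w, rfl⟩, rfl⟩ := Submodule.mem_sup.1 (hspan ▸ Submodule.mem_top (x := y))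
  obtain ⟨a, b, rfl⟩ := Submodule.mem_span_pair.1 hs
  obtain ⟨c, d, rfl⟩ := Submodule.mem_span_pair.1 hs'
  have hD : a * d - b * c ≠ 0 := by
    intro hD
    apply hxy
    rw [← ht, map_add t, LinearMap.map_add₂, (hrange z _).2, map_add (B _), (hrange _ w).1]
    simp only [map_add, map_smul, LinearMap.add_apply, LinearMap.smul_apply, halt, smul_eq_mul,
      hvu]
    linear_combination B (t u) v * hD
  have mem : ∀ p q : K, p • (a • u + b • v) + q • (c • u + d • v) ∈
      S ⊔ LinearMap.range (f - ε • 1) := by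
    intro p q
    have : p • (a • u + b • v) + q • (c • u + d • v) =
        (p • (a • u + b • v + (f - ε • 1) z) + q • (c • u + d • v + (f - ε • 1) w)) -
          (f - ε • 1) (p • z + q • w) := by
      simp only [map_add, map_smul]; module
    rw [this]
    exact Submodule.sub_mem _ (Submodule.mem_sup_left
      (S.add_mem (S.smul_mem _ hx) (S.smul_mem _ hy))) (Submodule.mem_sup_right ⟨_, rfl⟩)
  have hu' : u = ((a * d - b * c)⁻¹ * d) • (a • u + b • v) +
      (-((a * d - b * c)⁻¹ * b)) • (c • u + d • v) := by
    match_scalars <;> field_simp <;> ring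
  have hv' : v = (-((a * d - b * c)⁻¹ * c)) • (a • u + b • v) +
      ((a * d - b * c)⁻¹ * a) • (c • u + d • v) := by
    match_scalars <;> field_simp <;> ring
  rw [eq_top_iff, ← hspan]
  refine sup_le (Submodule.span_le.2 ?_) le_sup_right
  rintro _ (rfl | rfl)
  · rw [hu']; exact mem _ _
  · rw [hv']; exact mem _ _

lemma noOrthSplitting_of_eigenvalue [FiniteDimensional K M] [Nontrivial M]
    (h : IsReversal B f g σ) (h2 : (2 : K) ≠ 0) (hmin : OnlyTrivialSummands B f g σ)
    (hε : ε * ε = 1) {x : M} (hx : x ≠ 0) (hfx : f x = ε • x) : NoOrthSplitting B f g := by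
  have hgx : g x = ε • x := by
    rw [← h.inv_apply (ε • x), map_smul, hfx, smul_smul, hε, one_smul]
  have hsq : f * (f + g - (2 * ε) • 1) = (f - ε • 1) ^ 2 := by
    ext y
    simp only [pow_two, Module.End.mul_apply, LinearMap.sub_apply, LinearMap.add_apply, map_sub,
      map_add, LinearMap.smul_apply, map_smul, Module.End.one_apply, h.apply_inv, smul_sub,
      smul_smul, hε, one_smul, two_mul, add_smul]
    abel
  have hone : ∀ y : Module.End K M, Commute ((2 * ε) • (1 : Module.End K M)) y :=
    fun y => (Commute.one_left y).smul_left _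
  obtain ⟨N, hN⟩ := h.exists_pow_eq_zero hmin (T := f + g - (2 * ε) • 1)
    (fun y z => by
      rw [LinearMap.sub_apply, LinearMap.sub_apply, map_sub, map_sub, LinearMap.sub_apply,
        h.trace_selfAdjoint]
      simp)
    (h.trace_commute_left.sub_left (hone f)) (h.trace_commute_right.sub_left (hone g))
    (h.trace_commute_invol.sub_left (hone σ)) hx (by
      simp only [LinearMap.sub_apply, LinearMap.add_apply, LinearMap.smul_apply,
        Module.End.one_apply, hfx, hgx]
      module)
  obtain ⟨k, hk, hk0⟩ := exists_pow_ne_zero (T := f - ε • 1) ⟨2 * N, by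
    rw [pow_mul, ← hsq,
      Commute.mul_pow (h.trace_commute_left.sub_left (hone f)).symm, hN, mul_zero]⟩
  rcases Nat.even_or_odd k with hev | hodd
  · exact h.noOrthSplitting_of_even h2 hmin hε hk hk0 hev
  · exact h.noOrthSplitting_of_odd h2 hmin hε hk hk0 hodd

end Unipotent

/-- If there are no proper summands stable under both `f` and `σ`, then there are no proper
orthogonal summands for `f` alone. -/
theorem noOrthSplitting [FiniteDimensional K M] [Nontrivial M] (h : IsReversal B f g σ)
    (h2 : (2 : K) ≠ 0) (hmin : OnlyTrivialSummands B f g σ) : NoOrthSplitting B f g := by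
  by_cases hd : ∀ x, (f - g) x = 0 → x = 0
  · obtain ⟨u, hu⟩ := h.exists_cyclic_generator h2 hmin hd
    exact h.noOrthSplitting_of_cyclic hmin hu
  push Not at hd
  obtain ⟨x, hx, hx0⟩ := hd
  rw [LinearMap.sub_apply, sub_eq_zero] at hx
  by_cases hf : f x = (-1 : K) • x
  · exact h.noOrthSplitting_of_eigenvalue h2 hmin (by simp) hx0 hf
  refine h.noOrthSplitting_of_eigenvalue h2 hmin (ε := 1) (by simp) (x := f x + x) ?_ ?_
  · intro h0
    exact hf (by rw [neg_one_smul]; exact eq_neg_of_add_eq_zero_left h0)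
  · rw [map_add, one_smul, add_comm (f x) x]
    congr 1
    rw [hx, h.apply_inv]

end IsReversal

lemma sup_orthComp_eq [FiniteDimensional K M] (hsymm : ∀ x y, B x y = B y x)
    {W U : Submodule K M} (hWU : W ≤ U) (hW : IsNondegOn B W) : W ⊔ (U ⊓ orthComp B W) = U := by
  have hrefl : B.IsRefl := fun x y hxy => by rw [hsymm, hxy]
  have hnd : (B.restrict W).Nondegenerate := by
    refine ⟨fun x hx => ?_, fun x hx => ?_⟩
    · exact Subtype.ext (hW x x.2 fun y hy => hx ⟨y, hy⟩)
    · exact Subtype.ext (hW x x.2 fun y hy => by rw [hsymm]; exact hx ⟨y, hy⟩)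
  have hc := (LinearMap.BilinForm.isCompl_orthogonal_of_restrict_nondegenerate hrefl hnd).sup_eq_top
  refine le_antisymm (sup_le hWU inf_le_left) fun x hx => ?_
  obtain ⟨a, ha, b, hb, rfl⟩ := Submodule.mem_sup.1 (hc ▸ Submodule.mem_top (x := x))
  refine Submodule.mem_sup.2 ⟨a, ha, b, ⟨?_, fun y hy => ?_⟩, rfl⟩
  · simpa using U.sub_mem hx (hWU ha)
  · rw [hsymm]; exact hb y hy

lemma IsReversal.restrict {f g σ : Module.End K M} (h : IsReversal B f g σ) {U : Submodule K M}
    (hf : ∀ x ∈ U, f x ∈ U) (hg : ∀ x ∈ U, g x ∈ U) (hσ : ∀ x ∈ U, σ x ∈ U)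
    (hU : IsNondegOn B U) :
    IsReversal (B.restrict U) (f.restrict hf) (g.restrict hg) (σ.restrict hσ) where
  symm x y := h.symm x y
  nondeg x hx := Subtype.ext (hU x x.2 fun y hy => hx ⟨y, hy⟩)
  apply_inv x := Subtype.ext (h.apply_inv x)
  inv_apply x := Subtype.ext (h.inv_apply x)
  adjoint x y := h.adjoint x y
  invol x := Subtype.ext (h.invol x)
  invol_adjoint x y := h.invol_adjoint x y
  invol_apply x := Subtype.ext (h.invol_apply x)

lemma InvariantUnder.symm_mem [FiniteDimensional K M] {φ : M ≃ₗ[K] M} {U : Submodule K M}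
    (hU : InvariantUnder φ U) {x : M} (hx : x ∈ U) : φ.symm x ∈ U := by
  have hmap : U.map (φ : M →ₗ[K] M) = U :=
    Submodule.eq_of_le_of_finrank_eq (Submodule.map_le_iff_le_comap.2 hU)
      (LinearEquiv.finrank_map_eq φ U)
  obtain ⟨y, hy, rfl⟩ : x ∈ U.map (φ : M →ₗ[K] M) := hmap.symm ▸ hx
  simpa using hy

lemma indecomposableOn_of_minimal [FiniteDimensional K M] (h2 : (2 : K) ≠ 0) {φ σ : M ≃ₗ[K] M}
    (h : IsReversal B (φ : M →ₗ[K] M) (φ.symm : M →ₗ[K] M) (σ : M →ₗ[K] M))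
    {U : Submodule K M} (hU0 : U ≠ ⊥) (hU : IsNondegOn B U) (hφU : InvariantUnder φ U)
    (hσU : InvariantUnder σ U)
    (hmin : ∀ W ≤ U, IsNondegOn B W → InvariantUnder φ W → InvariantUnder σ W → W ≠ ⊥ → W = U) :
    IndecomposableOn B φ U := by
  refine ⟨hU0, fun W ⟨hWU, hφW, hW, hφW'⟩ => ?_⟩
  have hr := h.restrict (U := U) hφU (fun x hx => hφU.symm_mem hx) hσU hU
  have : Nontrivial U := Submodule.nontrivial_iff_ne_bot.2 hU0
  have hsplit := hr.noOrthSplitting h2 (fun Z hZf _ hZσ hZ hZ0 => by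
    have e := hmin (Z.map U.subtype) (Submodule.map_subtype_le U Z) ?_ ?_ ?_
      (fun hb => hZ0 (Submodule.map_injective_of_injective U.subtype_injective
        (hb.trans (Submodule.map_bot _).symm)))
    · rw [eq_top_iff]
      intro x _
      obtain ⟨z, hz, hzx⟩ : (x : M) ∈ Z.map U.subtype := e.symm ▸ x.2
      rwa [← Subtype.ext hzx]
    · rintro _ ⟨x, hx, rfl⟩ ho
      rw [hZ x hx fun y hy => ho y ⟨y, hy, rfl⟩, map_zero]
    · rintro _ ⟨x, hx, rfl⟩
      exact ⟨_, hZf x hx, rfl⟩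
    · rintro _ ⟨x, hx, rfl⟩
      exact ⟨_, hZσ x hx, rfl⟩)
  have hsum := sup_orthComp_eq h.symm hWU hW
  have htop : W.comap U.subtype ⊔ (U ⊓ orthComp B W).comap U.subtype = ⊤ := by
    rw [eq_top_iff]
    intro x _
    have hx : (x : M) ∈ W ⊔ (U ⊓ orthComp B W) := by rw [hsum]; exact x.2
    obtain ⟨a, ha, b, hb, hab⟩ := Submodule.mem_sup.1 hx
    exact Submodule.mem_sup.2 ⟨⟨a, hWU ha⟩, ha, ⟨b, hb.1⟩, hb, Subtype.ext hab⟩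
  rcases hsplit (W.comap U.subtype) ((U ⊓ orthComp B W).comap U.subtype)
    (fun x hx => hφW x hx) (fun x hx => hφW.symm_mem hx)
    (fun x hx => hφW' x hx) (fun x hx => hφW'.symm_mem hx)
    (fun x hx y hy => (h.symm _ _).trans (hy.2 x hx)) htop with hb | hb
  · left
    exact (Submodule.eq_bot_iff _).2 fun x hx =>
      congrArg Subtype.val ((Submodule.eq_bot_iff _).1 hb ⟨x, hWU hx⟩ hx)
  · right
    have : U ⊓ orthComp B W = ⊥ := (Submodule.eq_bot_iff _).2 fun x hx =>
      congrArg Subtype.val ((Submodule.eq_bot_iff _).1 hb ⟨x, hx.1⟩ hx)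
    rwa [this, sup_bot_eq] at hsum

lemma exists_orthogonal_decomposition [FiniteDimensional K M] (h2 : (2 : K) ≠ 0)
    {φ σ : M ≃ₗ[K] M}
    (h : IsReversal B (φ : M →ₗ[K] M) (φ.symm : M →ₗ[K] M) (σ : M →ₗ[K] M))
    (U : Submodule K M) (hU : IsNondegOn B U) (hφU : InvariantUnder φ U)
    (hσU : InvariantUnder σ U) :
    ∃ (ι : Type) (_ : Fintype ι) (Us : ι → Submodule K M), (⨆ i, Us i) = U ∧
      (∀ i j, i ≠ j → ∀ x ∈ Us i, ∀ y ∈ Us j, B x y = 0) ∧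
      (∀ i, IsNondegOn B (Us i) ∧ InvariantUnder φ (Us i) ∧ InvariantUnder σ (Us i) ∧
        IndecomposableOn B φ (Us i)) := by
  induction hn : Module.finrank K U using Nat.strong_induction_on generalizing U with
  | _ n ih =>
  subst hn
  by_cases hU0 : U = ⊥
  · exact ⟨Empty, inferInstance, Empty.elim, by simp [hU0], fun i => i.elim, fun i => i.elim⟩
  by_cases hmin : ∀ W ≤ U, IsNondegOn B W → InvariantUnder φ W → InvariantUnder σ W → W ≠ ⊥ →
      W = U
  · exact ⟨Unit, inferInstance, fun _ => U, by simp, fun i j hij => absurd rfl hij,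
      fun _ => ⟨hU, hφU, hσU, indecomposableOn_of_minimal h2 h hU0 hU hφU hσU hmin⟩⟩
  push Not at hmin
  obtain ⟨W, hWU, hW, hφW, hσW, hW0, hne⟩ := hmin
  have hsum := sup_orthComp_eq h.symm hWU hW
  have hW'ne : U ⊓ orthComp B W ≠ U := by
    intro e
    refine hW0 ((Submodule.eq_bot_iff _).2 fun x hx => hW x hx fun y hy => ?_)
    have : x ∈ U ⊓ orthComp B W := e.symm ▸ hWU hx
    exact this.2 y hy
  have hW' : IsNondegOn B (U ⊓ orthComp B W) := by
    intro x hx hxo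
    refine hU x hx.1 fun y hy => ?_
    obtain ⟨a, ha, b, hb, rfl⟩ := Submodule.mem_sup.1 (hsum.symm ▸ hy)
    rw [map_add, hx.2 a ha, hxo b hb, add_zero]
  have hφW' : InvariantUnder φ (U ⊓ orthComp B W) := fun x hx =>
    ⟨hφU x hx.1, fun y hy => (h.adjoint x y).trans (hx.2 _ (hφW.symm_mem hy))⟩
  have hσW' : InvariantUnder σ (U ⊓ orthComp B W) := fun x hx =>
    ⟨hσU x hx.1, fun y hy => (h.invol_adjoint x y).trans (hx.2 _ (hσW y hy))⟩
  obtain ⟨ι₁, _, U₁, hs₁, ho₁, hp₁⟩ := ih _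
    (Submodule.finrank_lt_finrank_of_lt (lt_of_le_of_ne hWU hne)) W hW hφW hσW rfl
  obtain ⟨ι₂, _, U₂, hs₂, ho₂, hp₂⟩ := ih _
    (Submodule.finrank_lt_finrank_of_lt (lt_of_le_of_ne inf_le_left hW'ne)) _ hW' hφW' hσW' rfl
  have hcross : ∀ i j, ∀ x ∈ U₁ i, ∀ y ∈ U₂ j, B y x = 0 := by
    intro i j x hx y hy
    have hx' : x ∈ W := hs₁ ▸ Submodule.mem_iSup_of_mem i hx
    have hy' : y ∈ U ⊓ orthComp B W := hs₂ ▸ Submodule.mem_iSup_of_mem j hy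
    exact hy'.2 x hx'
  refine ⟨ι₁ ⊕ ι₂, inferInstance, Sum.elim U₁ U₂, ?_, ?_, ?_⟩
  · rw [iSup_sum]
    simp only [Sum.elim_inl, Sum.elim_inr, hs₁, hs₂, hsum]
  · rintro (i | i) (j | j) hij x hx y hy
    · exact ho₁ i j (fun e => hij (congrArg _ e)) x hx y hy
    · rw [h.symm]; exact hcross i j x hx y hy
    · exact hcross j i y hy x hx
    · exact ho₂ i j (fun e => hij (congrArg _ e)) x hx y hy
  · rintro (i | i)
    · exact hp₁ i
    · exact hp₂ i

end Reversal

/-- If an involution `σ ∈ O(V)` reverses `φ ∈ O(V)`, then `V` decomposes orthogonally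
into `φ`- and `σ`-invariant subspaces on which `φ` is orthogonally indecomposable. -/
theorem reversing_involution_decomposition {K : Type*} [Field K] {M : Type*}
    [AddCommGroup M] [Module K M] [FiniteDimensional K M]
    (h2 : (2 : K) ≠ 0) (B : LinearMap.BilinForm K M)
    (hsymm : ∀ x y, B x y = B y x) (hnd : ∀ x, (∀ y, B x y = 0) → x = 0)
    (φ σ : M ≃ₗ[K] M) (hφ : φ ∈ OG B) (hσ : σ ∈ OG B)
    (hinv : σ ^ 2 = 1) (hrev : σ * φ * σ⁻¹ = φ⁻¹) :
    ∃ (m : ℕ) (Us : Fin m → Submodule K M),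
      (⨆ i, Us i) = ⊤ ∧
      (∀ i j, i ≠ j → ∀ x ∈ Us i, ∀ y ∈ Us j, B x y = 0) ∧
      (∀ i, IsNondegOn B (Us i) ∧ InvariantUnder φ (Us i) ∧ InvariantUnder σ (Us i) ∧
        IndecomposableOn B φ (Us i)) := by
  have hσσ : ∀ x, σ (σ x) = x := fun x => by
    have := LinearEquiv.congr_fun hinv x
    rwa [pow_two] at this
  have hσφ : ∀ x, σ (φ x) = φ.symm (σ x) := fun x => by
    rw [mul_inv_eq_iff_eq_mul] at hrev
    exact LinearEquiv.congr_fun hrev x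
  have h : IsReversal B (φ : M →ₗ[K] M) (φ.symm : M →ₗ[K] M) (σ : M →ₗ[K] M) :=
    { symm := hsymm
      nondeg := hnd
      apply_inv := φ.apply_symm_apply
      inv_apply := φ.symm_apply_apply
      adjoint := fun x y => by
        have := hφ x (φ.symm y)
        rwa [φ.apply_symm_apply] at this
      invol := hσσ
      invol_adjoint := fun x y => by
        have := hσ x (σ y)
        rwa [hσσ] at this
      invol_apply := hσφ }
  obtain ⟨ι, _, Us, hs, ho, hp⟩ := exists_orthogonal_decomposition h2 h ⊤
    (fun x _ hx => hnd x fun y => hx y trivial) (fun _ _ => trivial) (fun _ _ => trivial)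
  let e := (Fintype.equivFin ι).symm
  exact ⟨Fintype.card ι, Us ∘ e, by rw [← hs]; exact e.iSup_comp (g := Us),
    fun i j hij => ho _ _ (e.injective.ne hij), fun i => hp _⟩

end GenBireflect
end
end

section
/- Let φ ∈ O(V) be orthogonally indecomposable. Then: (1) if φ is of type 1 (V = W₁ ⊕ W₂ with W₁, W₂ nonzero φ-invariant subspaces on which φ is cyclic with equal minimal polynomials (x−ε)^m for some ε ∈ {1,−1}), then dim V ≡ 0 (mod 4); (2) dim V is odd if and only if φ is of type 2± (i.e. φ is cyclic on V with minimal polynomial (x−ε)^{dim V} for some ε ∈ {1,−1}). -/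
open Polynomial

noncomputable section

namespace GenBireflect

variable {K : Type*} [Field K] {M : Type*} [AddCommGroup M] [Module K M]
variable (B : LinearMap.BilinForm K M)

section NilpotentPart

variable {N S : Module.End K M}

/-- If `S * N` is adjoint to `N`, then `S ^ j * N ^ j` is adjoint to `N ^ j`. -/
theorem bilin_pow_left (hadj : ∀ x y, B (N x) y = B x (S (N y))) (hcomm : Commute S N)
    (j : ℕ) (x y : M) : B ((N ^ j) x) y = B x ((S ^ j) ((N ^ j) y)) := by
  rw [← Module.End.mul_apply, ← hcomm.mul_pow]
  induction j generalizing x with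
  | zero => simp
  | succ j ih => rw [pow_succ, Module.End.mul_apply, ih, hadj, pow_succ']; rfl

theorem bilin_pow_pow_eq_zero (hadj : ∀ x y, B (N x) y = B x (S (N y))) (hcomm : Commute S N)
    {m j k : ℕ} (hm : N ^ m = 0) (hjk : m ≤ j + k) (x y : M) :
    B ((N ^ j) x) ((N ^ k) y) = 0 := by
  rw [bilin_pow_left B hadj hcomm, ← Module.End.mul_apply (N ^ j), ← pow_add,
    pow_eq_zero_of_le hjk hm]
  simp

theorem bilin_pow_pow_eq (hadj : ∀ x y, B (N x) y = B x (S (N y))) (hcomm : Commute S N)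
    (hS : ∀ z, N z = 0 → S z = -z) {d j k : ℕ} (hd : N ^ (d + 1) = 0) (hjk : j + k = d)
    (x y : M) : B ((N ^ j) x) ((N ^ k) y) = (-1) ^ j * B x ((N ^ d) y) := by
  have hker : ∀ (i : ℕ) (z : M), N z = 0 → (S ^ i) z = (-1 : K) ^ i • z := by
    intro i z hz
    induction i with
    | zero => simp
    | succ i ih => rw [pow_succ', Module.End.mul_apply, ih, map_smul, hS z hz]; simp [pow_succ]
  have hz : N ((N ^ d) y) = 0 := by
    rw [← Module.End.mul_apply, ← pow_succ', hd]; rfl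
  rw [bilin_pow_left B hadj hcomm, ← Module.End.mul_apply (N ^ j), ← pow_add, hjk,
    hker _ _ hz, map_smul, smul_eq_mul]

theorem chain_coeff_eq_zero (hadj : ∀ x y, B (N x) y = B x (S (N y))) (hcomm : Commute S N)
    (hS : ∀ z, N z = 0 → S z = -z) {d : ℕ} (hd : N ^ (d + 1) = 0)
    {ι : Type*} [Fintype ι] (w : ι → M)
    (hw : ∀ a : ι → K, (∀ c, ∑ b, a b * B (w b) ((N ^ d) (w c)) = 0) → a = 0)
    (a : Fin (d + 1) × ι → K)
    (ha : ∀ k c, B (∑ p, a p • (N ^ (p.1 : ℕ)) (w p.2)) ((N ^ k) (w c)) = 0) : a = 0 := by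
  have key : ∀ (n : ℕ) (hn : n < d + 1) (b : ι), a (⟨n, hn⟩, b) = 0 := by
    intro n
    induction n using Nat.strong_induction_on with
    | _ n ih =>
      intro hn
      suffices h : (fun b => a (⟨n, hn⟩, b)) = 0 from fun b => congrFun h b
      refine hw _ fun c => ?_
      have h := ha (d - n) c
      simp only [map_sum, LinearMap.sum_apply, map_smul, LinearMap.smul_apply, smul_eq_mul,
        Fintype.sum_prod_type] at h
      rw [Finset.sum_eq_single ⟨n, hn⟩] at h
      · have h' : (-1 : K) ^ n * ∑ b, a (⟨n, hn⟩, b) * B (w b) ((N ^ d) (w c)) = 0 := by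
          rw [Finset.mul_sum, ← h]
          refine Finset.sum_congr rfl fun b _ => ?_
          rw [bilin_pow_pow_eq B hadj hcomm hS hd (by simp; omega)]
          simp only
          ring
        exact (mul_eq_zero.mp h').resolve_left (pow_ne_zero _ (by simp))
      · rintro ⟨i, hi⟩ - hne
        refine Finset.sum_eq_zero fun b _ => ?_
        rcases lt_or_ge i n with hlt | hge
        · rw [ih i hlt hi b, zero_mul]
        · have : i ≠ n := fun h => hne (by simp [h])
          rw [bilin_pow_pow_eq_zero B hadj hcomm hd (by simp; omega), mul_zero]
      · simp
  funext ⟨⟨n, hn⟩, b⟩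
  exact key n hn b

/-- The span of the truncated `N`-chains through the vectors `w b`. -/
def chainSpan (N : Module.End K M) (d : ℕ) {ι : Type*} (w : ι → M) : Submodule K M :=
  Submodule.span K (Set.range fun p : Fin (d + 1) × ι => (N ^ (p.1 : ℕ)) (w p.2))

theorem pow_mem_chainSpan {d : ℕ} (hd : N ^ (d + 1) = 0) {ι : Type*} (w : ι → M) (k : ℕ) (c : ι) :
    (N ^ k) (w c) ∈ chainSpan N d w := by
  rcases lt_or_ge k (d + 1) with h | h
  · exact Submodule.subset_span ⟨(⟨k, h⟩, c), rfl⟩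
  · simp [pow_eq_zero_of_le h hd]

theorem map_mem_chainSpan {d : ℕ} (hd : N ^ (d + 1) = 0) {ι : Type*} (w : ι → M) {x : M}
    (hx : x ∈ chainSpan N d w) : N x ∈ chainSpan N d w := by
  suffices h : chainSpan N d w ≤ (chainSpan N d w).comap N from h hx
  refine Submodule.span_le.mpr ?_
  rintro _ ⟨p, rfl⟩
  change N ((N ^ (p.1 : ℕ)) (w p.2)) ∈ chainSpan N d w
  rw [← Module.End.mul_apply, ← pow_succ']
  exact pow_mem_chainSpan hd w _ _

theorem isNondegOn_chainSpan (hadj : ∀ x y, B (N x) y = B x (S (N y))) (hcomm : Commute S N)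
    (hS : ∀ z, N z = 0 → S z = -z) {d : ℕ} (hd : N ^ (d + 1) = 0)
    {ι : Type*} [Fintype ι] (w : ι → M)
    (hw : ∀ a : ι → K, (∀ c, ∑ b, a b * B (w b) ((N ^ d) (w c)) = 0) → a = 0) :
    IsNondegOn B (chainSpan N d w) := by
  intro x hx hxy
  obtain ⟨a, rfl⟩ := (Submodule.mem_span_range_iff_exists_fun K).mp hx
  rw [chain_coeff_eq_zero B hadj hcomm hS hd w hw a
    fun k c => hxy _ (pow_mem_chainSpan hd w k c)]
  simp

theorem finrank_chainSpan (hadj : ∀ x y, B (N x) y = B x (S (N y))) (hcomm : Commute S N)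
    (hS : ∀ z, N z = 0 → S z = -z) {d : ℕ} (hd : N ^ (d + 1) = 0)
    {ι : Type*} [Fintype ι] (w : ι → M)
    (hw : ∀ a : ι → K, (∀ c, ∑ b, a b * B (w b) ((N ^ d) (w c)) = 0) → a = 0) :
    Module.finrank K (chainSpan N d w) = (d + 1) * Fintype.card ι := by
  have hli : LinearIndependent K fun p : Fin (d + 1) × ι => (N ^ (p.1 : ℕ)) (w p.2) := by
    rw [Fintype.linearIndependent_iff]
    intro a ha
    refine congrFun (chain_coeff_eq_zero B hadj hcomm hS hd w hw a fun k c => ?_)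
    rw [ha]
    simp
  rw [chainSpan, finrank_span_eq_card hli]
  simp

end NilpotentPart

section Isometry

variable {B} {φ : M ≃ₗ[K] M}

theorem bilin_symm_apply (hφ : φ ∈ OG B) (x y : M) : B (φ x) y = B x (φ.symm y) := by
  have h : B (φ x) (φ (φ.symm y)) = B x (φ.symm y) := hφ x (φ.symm y)
  rwa [φ.apply_symm_apply] at h

theorem symm_apply_mem [FiniteDimensional K M] {U : Submodule K M} (hU : InvariantUnder φ U)
    {x : M} (hx : x ∈ U) : φ.symm x ∈ U := by
  have hle : U.map (φ : M →ₗ[K] M) ≤ U := by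
    rintro _ ⟨y, hy, rfl⟩
    exact hU y hy
  have heq := Submodule.eq_of_le_of_finrank_eq hle (LinearEquiv.finrank_map_eq φ U)
  rw [← heq] at hx
  obtain ⟨y, hy, rfl⟩ := hx
  simpa using hy

theorem invariantUnder_orthComp [FiniteDimensional K M] (hφ : φ ∈ OG B) {U : Submodule K M}
    (hU : InvariantUnder φ U) : InvariantUnder φ (orthComp B U) := by
  intro x hx y hy
  rw [bilin_symm_apply hφ]
  exact hx _ (symm_apply_mem hU hy)

theorem Indecomposable.eq_top [FiniteDimensional K M] (hφ : φ ∈ OG B) (hind : Indecomposable B φ)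
    {U : Submodule K M} (hU : InvariantUnder φ U) (hnd : IsNondegOn B U) (hne : U ≠ ⊥) :
    U = ⊤ :=
  (hind.2 U ⟨le_top, hU, hnd, by rw [top_inf_eq]; exact invariantUnder_orthComp hφ hU⟩).resolve_left
    hne

/-- `φ - ε` for an isometry `φ`. -/
abbrev subScalar (φ : M ≃ₗ[K] M) (ε : K) : Module.End K M :=
  (φ : M →ₗ[K] M) - algebraMap K (Module.End K M) ε

/-- The factor `-ε φ⁻¹` relating `φ - ε` to its adjoint. -/
abbrev adjFactor (φ : M ≃ₗ[K] M) (ε : K) : Module.End K M :=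
  (-ε) • (φ.symm : M →ₗ[K] M)

theorem subScalar_apply (φ : M ≃ₗ[K] M) (ε : K) (x : M) : subScalar φ ε x = φ x - ε • x := rfl

theorem bilin_subScalar (hφ : φ ∈ OG B) {ε : K} (hε : ε * ε = 1) (x y : M) :
    B (subScalar φ ε x) y = B x (adjFactor φ ε (subScalar φ ε y)) := by
  have h : adjFactor φ ε (subScalar φ ε y) = φ.symm y - ε • y := by
    simp [smul_sub, smul_smul, hε]
  rw [h, subScalar_apply]
  simp [bilin_symm_apply hφ]

theorem commute_adjFactor (φ : M ≃ₗ[K] M) (ε : K) :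
    Commute (adjFactor φ ε) (subScalar φ ε) := by
  ext x
  simp

theorem adjFactor_apply_of_ker {ε : K} {z : M} (hz : subScalar φ ε z = 0) :
    adjFactor φ ε z = -z := by
  rw [subScalar_apply, sub_eq_zero] at hz
  have h : z = ε • φ.symm z := by
    rw [← map_smul, ← hz, φ.symm_apply_apply]
  simpa using h.symm

theorem apply_mem_of_subScalar_mem {ε : K} {U : Submodule K M}
    (h : ∀ x ∈ U, subScalar φ ε x ∈ U) : InvariantUnder φ U := by
  intro x hx
  have := U.add_mem (h x hx) (U.smul_mem ε hx)
  rwa [subScalar_apply, sub_add_cancel] at this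

theorem det_eq_of_bilin_adjoint [FiniteDimensional K M] (hsymm : ∀ x y, B x y = B y x)
    (hnd : ∀ x, (∀ y, B x y = 0) → x = 0) (f g : Module.End K M)
    (hfg : ∀ x y, B (f x) y = B x (g y)) : LinearMap.det f = LinearMap.det g := by
  have hinj : Function.Injective B := by
    rw [← LinearMap.ker_eq_bot, LinearMap.ker_eq_bot']
    exact fun x hx => hnd x fun y => by rw [hx]; rfl
  let e : M ≃ₗ[K] Module.Dual K M :=
    LinearEquiv.ofInjectiveOfFinrankEq B hinj Subspace.dual_finrank_eq.symm
  have he : ∀ x, e x = B x := fun x => rfl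
  have hconj : f.dualMap = (e : M →ₗ[K] Module.Dual K M) ∘ₗ g ∘ₗ
      (e.symm : Module.Dual K M →ₗ[K] M) := by
    ext l x
    obtain ⟨y, rfl⟩ := e.surjective l
    rw [LinearMap.comp_apply, LinearMap.comp_apply, LinearEquiv.coe_coe, LinearEquiv.coe_coe,
      e.symm_apply_apply, LinearMap.dualMap_apply, he, he]
    rw [hsymm, hfg, hsymm]
  rw [← LinearMap.det_dualMap, hconj, LinearMap.det_conj]

theorem exists_det_subScalar_eq_zero [FiniteDimensional K M] (h2 : (2 : K) ≠ 0)
    (hsymm : ∀ x y, B x y = B y x) (hnd : ∀ x, (∀ y, B x y = 0) → x = 0)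
    (hφ : φ ∈ OG B) (hodd : Odd (Module.finrank K M)) :
    ∃ ε : K, ε * ε = 1 ∧ LinearMap.det (subScalar φ ε) = 0 := by
  have hdet : LinearMap.det (φ : M →ₗ[K] M) = LinearMap.det (φ.symm : M →ₗ[K] M) :=
    det_eq_of_bilin_adjoint hsymm hnd _ _ fun x y => bilin_symm_apply hφ x y
  set δ := LinearMap.det (φ.symm : M →ₗ[K] M) with hδ
  have hδ1 : δ * δ = 1 := by
    nth_rewrite 1 [← hdet]
    rw [hδ, ← LinearMap.det_comp]
    simp
  refine ⟨δ, hδ1, ?_⟩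
  have h := det_eq_of_bilin_adjoint hsymm hnd (subScalar φ δ)
    (adjFactor φ δ * subScalar φ δ) fun x y => bilin_subScalar hφ hδ1 x y
  rw [map_mul, LinearMap.det_smul, hodd.neg_pow, ← hδ] at h
  have hpow : δ ^ Module.finrank K M = δ := by
    obtain ⟨k, hk⟩ := hodd
    rw [hk, pow_succ, pow_mul, pow_two, hδ1, one_pow, one_mul]
  rw [hpow, neg_mul, hδ1] at h
  have : (2 : K) * LinearMap.det (subScalar φ δ) = 0 := by linear_combination h
  exact (mul_eq_zero.mp this).resolve_left h2

theorem Indecomposable.isNilpotent_subScalar [FiniteDimensional K M]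
    (hsymm : ∀ x y, B x y = B y x) (hnd : ∀ x, (∀ y, B x y = 0) → x = 0)
    (hφ : φ ∈ OG B) (hind : Indecomposable B φ) {ε : K} (hε : ε * ε = 1)
    (hdet : LinearMap.det (subScalar φ ε) = 0) : IsNilpotent (subScalar φ ε) := by
  set N := subScalar φ ε with hN
  obtain ⟨k, hk1, hk⟩ :=
    ((Filter.eventually_ge_atTop 1).and N.eventually_isCompl_ker_pow_range_pow).exists
  refine ⟨k, LinearMap.ker_eq_top.mp (hind.eq_top hφ ?_ ?_ ?_)⟩
  · refine apply_mem_of_subScalar_mem (ε := ε) fun x hx => ?_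
    rw [LinearMap.mem_ker] at hx ⊢
    rw [← hN, ← Module.End.mul_apply, ← pow_succ, pow_succ', Module.End.mul_apply, hx, map_zero]
  · intro x hx hxy
    refine hnd x fun y => ?_
    obtain ⟨y₁, hy₁, y₂, ⟨z, rfl⟩, rfl⟩ := Submodule.mem_sup.mp
      (hk.sup_eq_top ▸ Submodule.mem_top : y ∈ LinearMap.ker (N ^ k) ⊔ LinearMap.range (N ^ k))
    rw [map_add, hxy y₁ hy₁, hsymm x,
      bilin_pow_left B (bilin_subScalar hφ hε) (commute_adjFactor φ ε), LinearMap.mem_ker.mp hx]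
    simp
  · have hne : LinearMap.ker N ≠ ⊥ := (LinearMap.bot_lt_ker_of_det_eq_zero hdet).ne'
    refine fun h => hne (eq_bot_iff.mpr fun x hx => ?_)
    rw [← h, LinearMap.mem_ker]
    exact Module.End.pow_map_zero_of_le hk1 (by simpa using hx)

/-- An indecomposable isometry `φ` with `φ - ε` nilpotent of index `m` is either cyclic with `m`
odd, or `m` is even and the space has dimension `2 * m`. -/
theorem Indecomposable.cyclic_or_finrank_eq [FiniteDimensional K M] (h2 : (2 : K) ≠ 0)
    (hsymm : ∀ x y, B x y = B y x) (hnd : ∀ x, (∀ y, B x y = 0) → x = 0)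
    (hφ : φ ∈ OG B) (hind : Indecomposable B φ) {ε : K} (hε : ε * ε = 1)
    {d : ℕ} (hd : subScalar φ ε ^ (d + 1) = 0) (hd' : subScalar φ ε ^ d ≠ 0) :
    (Odd (d + 1) ∧ Module.finrank K M = d + 1 ∧ CyclicOn φ ⊤) ∨
      (Even (d + 1) ∧ Module.finrank K M = 2 * (d + 1)) := by
  set N := subScalar φ ε with hN
  have hadj : ∀ x y, B (N x) y = B x (adjFactor φ ε (N y)) := bilin_subScalar hφ hε
  have hcomm : Commute (adjFactor φ ε) N := commute_adjFactor φ ε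
  have hS : ∀ z, N z = 0 → adjFactor φ ε z = -z := fun z hz => adjFactor_apply_of_ker hz
  have hflip : ∀ x y, B x ((N ^ d) y) = (-1) ^ d * B y ((N ^ d) x) := by
    intro x y
    rw [hsymm]
    simpa using bilin_pow_pow_eq B hadj hcomm hS hd (Nat.add_zero d) y x
  obtain ⟨u, v, huv⟩ : ∃ u v, B u ((N ^ d) v) ≠ 0 := by
    by_contra! h
    refine hd' (LinearMap.ext fun v => hnd _ fun u => ?_)
    rw [hsymm, h]
  have htop : ∀ {ι : Type} [Fintype ι] [Nonempty ι] (w : ι → M),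
      (∀ a : ι → K, (∀ c, ∑ b, a b * B (w b) ((N ^ d) (w c)) = 0) → a = 0) →
      chainSpan N d w = ⊤ ∧ Module.finrank K M = (d + 1) * Fintype.card ι := by
    intro ι _ _ w hw
    have hrank := finrank_chainSpan B hadj hcomm hS hd w hw
    have heq : chainSpan N d w = ⊤ := by
      refine hind.eq_top hφ (apply_mem_of_subScalar_mem (ε := ε) fun x hx =>
        map_mem_chainSpan hd w hx) (isNondegOn_chainSpan B hadj hcomm hS hd w hw) ?_
      intro h
      rw [h, finrank_bot] at hrank
      exact (Nat.mul_pos d.succ_pos Fintype.card_pos).ne hrank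
    exact ⟨heq, by rw [← hrank, heq, finrank_top]⟩
  rcases Nat.even_or_odd d with hpar | hpar
  · left
    obtain ⟨u, hu⟩ : ∃ u, B u ((N ^ d) u) ≠ 0 := by
      by_contra! h
      have hs := hflip u v
      have huv' := h (u + v)
      simp only [map_add, LinearMap.add_apply, h] at huv'
      rw [hpar.neg_one_pow, one_mul] at hs
      have : (2 : K) * B u ((N ^ d) v) = 0 := by linear_combination huv' + hs
      exact huv ((mul_eq_zero.mp this).resolve_left h2)
    obtain ⟨hspan, hrank⟩ := htop (fun _ : Unit => u) fun a ha => by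
      have := ha ()
      simp only [Finset.univ_unique, Finset.sum_singleton] at this
      exact funext fun _ => (mul_eq_zero.mp this).resolve_right hu
    refine ⟨hpar.add_one, by simpa using hrank, u, (top_le_iff.mp ?_).symm⟩
    set W := Submodule.span K (Set.range fun i : ℕ => ((φ : M →ₗ[K] M) ^ i) u) with hW
    have hφW : ∀ x ∈ W, N x ∈ W := by
      intro x hx
      refine W.sub_mem ?_ (W.smul_mem ε hx)
      suffices h : W ≤ W.comap (φ : M →ₗ[K] M) from h hx
      refine Submodule.span_le.mpr ?_
      rintro _ ⟨i, rfl⟩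
      exact Submodule.subset_span ⟨i + 1, by simp only [pow_succ']; rfl⟩
    rw [← hspan]
    refine Submodule.span_le.mpr ?_
    rintro _ ⟨⟨i, c⟩, rfl⟩
    change (N ^ (i : ℕ)) u ∈ W
    induction (i : ℕ) with
    | zero => exact Submodule.subset_span ⟨0, by simp⟩
    | succ i ih => rw [pow_succ', Module.End.mul_apply]; exact hφW _ ih
  · right
    have halt : ∀ x, B x ((N ^ d) x) = 0 := by
      intro x
      have h := hflip x x
      rw [hpar.neg_one_pow] at h
      have : (2 : K) * B x ((N ^ d) x) = 0 := by linear_combination h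
      exact (mul_eq_zero.mp this).resolve_left h2
    have hvu : B v ((N ^ d) u) ≠ 0 := by
      intro h
      exact huv (by rw [hflip, h, mul_zero])
    obtain ⟨-, hrank⟩ := htop ![u, v] fun a ha => by
      have h0 := ha 0
      have h1 := ha 1
      simp only [Fin.sum_univ_two, Matrix.cons_val_zero, Matrix.cons_val_one, halt, mul_zero,
        zero_add, add_zero, mul_eq_zero, hvu, huv, or_false] at h0 h1
      ext i
      fin_cases i
      · exact h1
      · exact h0
    exact ⟨hpar.add_one, by rw [hrank, Fintype.card_fin, mul_comm]⟩

end Isometry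

theorem aeval_X_sub_C_pow (φ : M ≃ₗ[K] M) (ε : K) (m : ℕ) :
    aeval (φ : M →ₗ[K] M) ((X - C ε) ^ m) = subScalar φ ε ^ m := by
  simp

theorem minpoly_subScalar [FiniteDimensional K M] {φ : M ≃ₗ[K] M} {ε : K} {d : ℕ}
    (hd : subScalar φ ε ^ (d + 1) = 0) (hd' : subScalar φ ε ^ d ≠ 0) :
    minpoly K (φ : M →ₗ[K] M) = (X - C ε) ^ (d + 1) := by
  have hdvd := minpoly.dvd K (φ : M →ₗ[K] M) ((aeval_X_sub_C_pow φ ε (d + 1)).trans hd)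
  obtain ⟨k, hk, hassoc⟩ := (dvd_prime_pow (prime_X_sub_C ε) _).mp hdvd
  have heq := eq_of_monic_of_associated
    (minpoly.monic (Algebra.IsIntegral.isIntegral (R := K) (φ : M →ₗ[K] M)))
    ((monic_X_sub_C ε).pow k) hassoc
  have hk0 : subScalar φ ε ^ k = 0 := by
    rw [← aeval_X_sub_C_pow, ← heq, minpoly.aeval]
  rcases hk.lt_or_eq with h | rfl
  · exact absurd (pow_eq_zero_of_le (Nat.lt_succ_iff.mp h) hk0) hd'
  · exact heq

/-- On an invariant subspace with minimal polynomial `(X - ε) ^ m`, a power of `φ - ε` vanishes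
iff its exponent is at least `m`. -/
theorem MinpolyOn.subScalar_pow_eq_zero_iff {φ : M ≃ₗ[K] M} {W : Submodule K M} {ε : K} {m : ℕ}
    (h : MinpolyOn φ W ((X - C ε) ^ m)) (k : ℕ) :
    (∀ x ∈ W, (subScalar φ ε ^ k) x = 0) ↔ m ≤ k := by
  obtain ⟨hW, hmin⟩ := h
  have hval : ∀ x : W, ((aeval ((φ : M →ₗ[K] M).restrict hW) ((X - C ε) ^ k) x : W) : M) =
      (subScalar φ ε ^ k) x := by
    induction k with
    | zero => simp
    | succ k ih =>
      intro x
      rw [pow_succ, pow_succ, map_mul, Module.End.mul_apply, ih, Module.End.mul_apply]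
      simp
  have hdvd : (∀ x ∈ W, (subScalar φ ε ^ k) x = 0) ↔
      minpoly K ((φ : M →ₗ[K] M).restrict hW) ∣ (X - C ε) ^ k := by
    rw [minpoly.dvd_iff, LinearMap.ext_iff]
    refine ⟨fun h x => Subtype.ext ((hval x).trans (h x x.2)), fun h x hx => ?_⟩
    rw [← hval ⟨x, hx⟩, h ⟨x, hx⟩]
    rfl
  rw [hdvd, hmin]
  exact pow_dvd_pow_iff (X_sub_C_ne_zero ε) (not_isUnit_X_sub_C ε)

theorem MinpolyOn.le_finrank [FiniteDimensional K M] {φ : M ≃ₗ[K] M} {W : Submodule K M}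
    {f : K[X]} (h : MinpolyOn φ W f) : f.natDegree ≤ Module.finrank K W := by
  obtain ⟨hW, rfl⟩ := h
  rw [← LinearMap.charpoly_natDegree ((φ : M →ₗ[K] M).restrict hW)]
  exact natDegree_le_of_dvd (LinearMap.minpoly_dvd_charpoly _) (LinearMap.charpoly_monic _).ne_zero

theorem mul_self_eq_one_of_eq_or {ε : K} (hε : ε = 1 ∨ ε = -1) : ε * ε = 1 :=
  mul_self_eq_one_iff.mpr hε

/-- Huppert: an orthogonally indecomposable `φ` of type 1 acts on a space of dimension
`≡ 0 (mod 4)`; moreover `dim V` is odd iff `φ` is of type 2±. -/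
theorem indecomposable_type_dims {K : Type*} [Field K] {M : Type*}
    [AddCommGroup M] [Module K M] [FiniteDimensional K M]
    (h2 : (2 : K) ≠ 0) (B : LinearMap.BilinForm K M)
    (hsymm : ∀ x y, B x y = B y x) (hnd : ∀ x, (∀ y, B x y = 0) → x = 0)
    (φ : M ≃ₗ[K] M) (hφ : φ ∈ OG B) (hind : Indecomposable B φ) :
    (IsType1 φ → Module.finrank K M % 4 = 0) ∧
    (Odd (Module.finrank K M) ↔ IsType2pm φ) := by
  have hnontriv : Nontrivial M := by
    by_contra h
    rw [not_nontrivial_iff_subsingleton] at h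
    exact hind.1 (Subsingleton.elim _ _)
  refine ⟨?_, ?_, ?_⟩
  · rintro ⟨W₁, W₂, ε, m, hW₁, -, hinf, hsup, -, -, -, -, hε, hm₁, hm₂⟩
    have hm : m ≠ 0 := by
      rintro rfl
      refine hW₁ (eq_bot_iff.mpr fun x hx => ?_)
      simpa using (hm₁.subScalar_pow_eq_zero_iff 0).mpr le_rfl x hx
    obtain ⟨d, rfl⟩ := Nat.exists_eq_succ_of_ne_zero hm
    have hd : subScalar φ ε ^ (d + 1) = 0 := by
      refine LinearMap.ker_eq_top.mp (top_le_iff.mp (hsup ▸ sup_le ?_ ?_))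
      · exact fun x hx => (hm₁.subScalar_pow_eq_zero_iff _).mpr le_rfl x hx
      · exact fun x hx => (hm₂.subScalar_pow_eq_zero_iff _).mpr le_rfl x hx
    have hd' : subScalar φ ε ^ d ≠ 0 := fun h =>
      absurd ((hm₁.subScalar_pow_eq_zero_iff d).mp fun x _ => by rw [h]; rfl) (by omega)
    have hrank := Submodule.finrank_sup_add_finrank_inf_eq W₁ W₂
    rw [hsup, hinf, finrank_top, finrank_bot] at hrank
    have h₁ := hm₁.le_finrank
    have h₂ := hm₂.le_finrank
    rw [natDegree_pow, natDegree_X_sub_C] at h₁ h₂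
    rcases hind.cyclic_or_finrank_eq h2 hsymm hnd hφ (mul_self_eq_one_of_eq_or hε) hd hd' with
      ⟨-, h, -⟩ | ⟨⟨k, hk⟩, h⟩ <;> omega
  · intro hodd
    obtain ⟨ε, hε, hdet⟩ := exists_det_subScalar_eq_zero h2 hsymm hnd hφ hodd
    have hnil := hind.isNilpotent_subScalar hsymm hnd hφ hε hdet
    obtain ⟨d, hdeq⟩ := Nat.exists_eq_succ_of_ne_zero (pos_nilpotencyClass_iff.mpr hnil).ne'
    obtain ⟨hd, hd'⟩ := (nilpotencyClass_eq_succ_iff).mp hdeq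
    rcases hind.cyclic_or_finrank_eq h2 hsymm hnd hφ hε hd hd' with ⟨-, h, hcyc⟩ | ⟨-, h⟩
    · exact ⟨hcyc, ε, mul_self_eq_one_iff.mp hε, h ▸ minpoly_subScalar hd hd'⟩
    · rw [h] at hodd
      exact absurd hodd (Nat.not_odd_iff_even.mpr (even_two_mul _))
  · rintro ⟨-, ε, hε, hmin⟩
    obtain ⟨d, hdeq⟩ := Nat.exists_eq_succ_of_ne_zero (Module.finrank_pos (R := K) (M := M)).ne'
    rw [hdeq] at hmin
    have hd : subScalar φ ε ^ (d + 1) = 0 := by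
      rw [← aeval_X_sub_C_pow, ← Nat.succ_eq_add_one, ← hmin, minpoly.aeval]
    have hd' : subScalar φ ε ^ d ≠ 0 := by
      intro h
      have hdvd := minpoly.dvd K (φ : M →ₗ[K] M) ((aeval_X_sub_C_pow φ ε d).trans h)
      rw [hmin, pow_dvd_pow_iff (X_sub_C_ne_zero ε) (not_isUnit_X_sub_C ε)] at hdvd
      omega
    rcases hind.cyclic_or_finrank_eq h2 hsymm hnd hφ (mul_self_eq_one_of_eq_or hε) hd hd' with
      ⟨ho, h, -⟩ | ⟨-, h⟩
    · rwa [h]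
    · omega

end GenBireflect
end
end
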